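/- arXiv:1905.10180 — 5 statements merged into one kernel-verified Lean document; each statement's English description precedes it below -/
import Mathlib

section
/- R(2) ≤ 0.5753 and R(4) ≤ 0.4451, where R(t) = limsup_{n→∞} (log₂ A(n,t))/n is the largest asymptotic code rate of t-signature codes. -/
open Finset

/-- A binary code of length `n`: every coordinate of every codeword is 0 or 1. -/
def IsBinaryCode {n : ℕ} (C : Finset (Fin n → ℝ)) : Prop :=
  ∀ c ∈ C, ∀ i, c i = 0 ∨ c i = 1

/-- `C` is a `t`-signature code. -/
def IsSignatureCode {n : ℕ} (t : ℕ) (C : Finset (Fin n → ℝ)) : Prop :=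
  ∀ C₁ ⊆ C, ∀ C₂ ⊆ C, C₁ ≠ C₂ →
    1 ≤ C₁.card → C₁.card ≤ t → 1 ≤ C₂.card → C₂.card ≤ t →
    ∀ lam mu : (Fin n → ℝ) → ℝ,
      (∀ c ∈ C₁, 0 < lam c) → (∀ c ∈ C₂, 0 < mu c) →
      (∑ c ∈ C₁, lam c) = 1 → (∑ c ∈ C₂, mu c) = 1 →
      (∑ c ∈ C₁, lam c • c) ≠ (∑ c ∈ C₂, mu c • c)

/-- `A n t`: the maximum size of a `t`-signature code of length `n`. -/
noncomputable def Amax (n t : ℕ) : ℕ :=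
  sSup {M | ∃ C : Finset (Fin n → ℝ), IsBinaryCode C ∧ IsSignatureCode t C ∧ C.card = M}

open Polynomial in
/-- The linear functional `X ^ k ↦ a k` on polynomials. -/
noncomputable def coeffFunctional (a : ℕ → ℝ) : ℝ[X] →ₗ[ℝ] ℝ :=
  Polynomial.lsum fun k => a k • LinearMap.id

section Functional
open Polynomial

lemma coeffFunctional_monomial (a : ℕ → ℝ) (k : ℕ) (c : ℝ) :
    coeffFunctional a (monomial k c) = a k * c := by
  simp [coeffFunctional, Polynomial.lsum_apply, Polynomial.sum_monomial_index]

lemma coeffFunctional_X_mul (a : ℕ → ℝ) (p : ℝ[X]) :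
    coeffFunctional a (X * p) = coeffFunctional (fun k => a (k + 1)) p := by
  induction p using Polynomial.induction_on' with
  | add p q hp hq => simp [mul_add, hp, hq]
  | monomial k c => simp [X_mul_monomial, coeffFunctional_monomial]

lemma coeffFunctional_derivative (a : ℕ → ℝ) (p : ℝ[X]) :
    coeffFunctional a (derivative p) = coeffFunctional (fun k => k * a (k - 1)) p := by
  induction p using Polynomial.induction_on' with
  | add p q hp hq => simp [hp, hq]
  | monomial k c => simp [derivative_monomial, coeffFunctional_monomial]; ring

lemma coeffFunctional_add (a b : ℕ → ℝ) (p : ℝ[X]) :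
    coeffFunctional (fun k => a k + b k) p = coeffFunctional a p + coeffFunctional b p := by
  induction p using Polynomial.induction_on' with
  | add p q hp hq => simp [hp, hq]; ring
  | monomial k c => simp [coeffFunctional_monomial]; ring

lemma coeffFunctional_sub (a b : ℕ → ℝ) (p : ℝ[X]) :
    coeffFunctional (fun k => a k - b k) p = coeffFunctional a p - coeffFunctional b p := by
  induction p using Polynomial.induction_on' with
  | add p q hp hq => simp [hp, hq]; ring
  | monomial k c => simp [coeffFunctional_monomial]; ring

lemma coeffFunctional_mul (r : ℝ) (a : ℕ → ℝ) (p : ℝ[X]) :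
    coeffFunctional (fun k => r * a k) p = r * coeffFunctional a p := by
  induction p using Polynomial.induction_on' with
  | add p q hp hq => simp [hp, hq]; ring
  | monomial k c => simp [coeffFunctional_monomial]; ring

end Functional

/-- The normalised coordinate function on the cube with bias `1 / 10`. -/
noncomputable def biasedChar {ι : Type*} [DecidableEq ι] (x : Finset ι) (i : ι) : ℝ :=
  if i ∈ x then 3 else -(1 / 3)

/-- The product of the coordinate functions over `T`. -/
noncomputable def biasedProd {ι : Type*} [DecidableEq ι] (T x : Finset ι) : ℝ :=
  ∏ i ∈ T, biasedChar x i

/-- The kernel with weight `a k` on degree `k`. -/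
noncomputable def kern {ι : Type*} [Fintype ι] [DecidableEq ι] (a : ℕ → ℝ) (x y : Finset ι) : ℝ :=
  ∑ T : Finset ι, a T.card * (biasedProd T x * biasedProd T y)

open Polynomial in
/-- The generating polynomial of the kernels. -/
noncomputable def genPoly {ι : Type*} [Fintype ι] [DecidableEq ι] (x y : Finset ι) : ℝ[X] :=
  ∏ i, (1 + C (biasedChar x i * biasedChar y i) * X)

open Polynomial in
lemma coeffFunctional_genPoly {ι : Type*} [Fintype ι] [DecidableEq ι] (a : ℕ → ℝ) (x y : Finset ι) :
    coeffFunctional a (genPoly x y) = kern a x y := by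
  have : genPoly x y = ∑ T : Finset ι, monomial T.card (biasedProd T x * biasedProd T y) := by
    rw [genPoly, Finset.prod_one_add]
    simp only [Finset.prod_mul_distrib, Finset.prod_const, ← map_prod]
    rw [Finset.powerset_univ]
    refine Finset.sum_congr rfl fun T _ => ?_
    rw [C_mul_X_pow_eq_monomial]
    rfl
  rw [this, map_sum]
  simp [coeffFunctional_monomial, kern]

lemma sum_biasedChar {ι : Type*} [Fintype ι] [DecidableEq ι] (x : Finset ι)
    (hx : 10 * x.card = Fintype.card ι) :
    ∑ i, biasedChar x i = 0 := by
  have h : ∀ i, biasedChar x i = (if i ∈ x then (10 / 3 : ℝ) else 0) + (-(1 / 3)) := by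
    intro i; unfold biasedChar; split_ifs <;> norm_num
  simp only [h, sum_add_distrib, sum_ite_mem, univ_inter, sum_const, nsmul_eq_mul, card_univ]
  rw [← hx]; push_cast; ring

lemma biasedChar_sq {ι : Type*} [DecidableEq ι] (x : Finset ι) (i : ι) :
    biasedChar x i ^ 2 = 1 + 8 / 3 * biasedChar x i := by
  unfold biasedChar; split_ifs <;> norm_num

open scoped symmDiff in
lemma sum_biasedChar_mul {ι : Type*} [Fintype ι] [DecidableEq ι] (x y : Finset ι)
    (hx : 10 * x.card = Fintype.card ι)
    (hy : 10 * y.card = Fintype.card ι) :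
    ∑ i, biasedChar x i * biasedChar y i = Fintype.card ι - 50 / 9 * (x ∆ y).card := by
  have h : ∀ i, biasedChar x i * biasedChar y i =
      1 + (4 / 3) * (biasedChar x i + biasedChar y i) + (if i ∈ x ∆ y then -(50 / 9 : ℝ) else 0) := by
    intro i
    unfold biasedChar
    by_cases h1 : i ∈ x <;> by_cases h2 : i ∈ y <;> simp [h1, h2, mem_symmDiff] <;> norm_num
  simp only [h, sum_add_distrib, ← mul_sum, sum_biasedChar x hx, sum_biasedChar y hy,
    sum_ite_mem, univ_inter, sum_const, nsmul_eq_mul, card_univ]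
  ring

open Polynomial in
lemma genPoly_identity {ι : Type*} [Fintype ι] [DecidableEq ι] (x y : Finset ι)
    (hx : 10 * x.card = Fintype.card ι)
    (hy : 10 * y.card = Fintype.card ι) :
    (1 + X) * (C (∑ i, biasedChar x i * biasedChar y i) * genPoly x y) =
      (1 + X) * (derivative (genPoly x y) + X * (C (Fintype.card ι : ℝ) * genPoly x y
        - X * derivative (genPoly x y)) + C (64 / 9) * (X * derivative (genPoly x y)))
      - C (128 / 9) * (X * (X * derivative (genPoly x y))) := by
  set u : ι → ℝ := fun i => biasedChar x i * biasedChar y i with hu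
  set s : ι → ℝ := fun i => biasedChar x i + biasedChar y i with hs
  set P : ι → ℝ[X] := fun i => ∏ j ∈ univ.erase i, (1 + C (u j) * X) with hP
  set F := genPoly x y with hF
  have hFP : ∀ i, F = (1 + C (u i) * X) * P i := fun i =>
    (Finset.mul_prod_erase univ (fun j => 1 + C (u j) * X) (mem_univ i)).symm
  have hd : derivative F = ∑ i, C (u i) * P i := by
    rw [hF, genPoly, derivative_prod_finset]
    refine Finset.sum_congr rfl fun i _ => ?_
    simp [hP, hu]; ring
  have hsumP : ∑ i, P i = C (Fintype.card ι : ℝ) * F - X * derivative F := by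
    have : ∀ i, P i = F - X * (C (u i) * P i) := by
      intro i; linear_combination -(hFP i)
    rw [Finset.sum_congr rfl fun i _ => this i, sum_sub_distrib, ← mul_sum, ← hd]
    simp
  have hs0 : ∑ i, s i = 0 := by
    simp [hs, sum_add_distrib, sum_biasedChar x hx, sum_biasedChar y hy]
  have hsu : ∀ i, s i * u i = s i + 16 / 3 * u i := by
    intro i
    have h1 := biasedChar_sq x i
    have h2 := biasedChar_sq y i
    simp only [hs, hu]
    linear_combination biasedChar y i * h1 + biasedChar x i * h2
  have huu : ∀ i, u i * u i = 1 + 8 / 3 * s i + 64 / 9 * u i := by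
    intro i
    have h1 := biasedChar_sq x i
    have h2 := biasedChar_sq y i
    simp only [hs, hu]
    linear_combination biasedChar y i ^ 2 * h1 + (1 + 8 / 3 * biasedChar x i) * h2
  have hC : (1 + X) * ∑ i, C (s i) * P i + C (16 / 3) * (X * derivative F) = 0 := by
    have h0 : (0 : ℝ[X]) = ∑ i, C (s i) * F := by
      rw [← sum_mul, ← map_sum, hs0]; simp
    rw [h0, hd, mul_sum, mul_sum, mul_sum, ← sum_add_distrib]
    refine Finset.sum_congr rfl fun i _ => ?_
    have h1 : C (s i) * C (u i) = C (s i) + C (16 / 3) * C (u i) := by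
      rw [← C_mul, ← C_mul, ← C_add, hsu]
    rw [hFP i]
    linear_combination (-(X * P i)) * h1
  have hΨ : C (∑ i, u i) * F = derivative F + X * ∑ i, P i + C (8 / 3) * (X * ∑ i, C (s i) * P i)
      + C (64 / 9) * (X * derivative F) := by
    rw [map_sum, sum_mul, hd]
    simp only [mul_sum, ← sum_add_distrib]
    refine Finset.sum_congr rfl fun i _ => ?_
    have h1 : C (u i) * C (u i) = 1 + C (8 / 3) * C (s i) + C (64 / 9) * C (u i) := by
      rw [← C_mul, ← C_mul, ← C_mul, ← C_1, ← C_add, ← C_add, huu]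
    rw [hFP i]
    linear_combination (X * P i) * h1
  have h128 : (C (128 / 9) : ℝ[X]) = C (8 / 3) * C (16 / 3) := by rw [← C_mul]; norm_num
  rw [hΨ, hsumP, h128]
  linear_combination C (8 / 3) * X * hC

/-- Multiplication by the distance kernel acts on the kernels by a three-term type recurrence. -/
lemma dist_mul_kern {ι : Type*} [Fintype ι] [DecidableEq ι] (a : ℕ → ℝ) (x y : Finset ι)
    (hx : 10 * x.card = Fintype.card ι)
    (hy : 10 * y.card = Fintype.card ι) :
    (∑ i, biasedChar x i * biasedChar y i) * kern (fun k => a k + a (k + 1)) x y =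
      kern (fun j => j * (a (j - 1) + a j) + (Fintype.card ι - j) * (a (j + 1) + a (j + 2))
        + 64 / 9 * (j * (a j - a (j + 1)))) x y := by
  have h := congrArg (coeffFunctional a) (genPoly_identity x y hx hy)
  simp only [add_mul, one_mul, mul_add, mul_sub, map_add, map_sub, ← Polynomial.smul_eq_C_mul,
    mul_smul_comm, map_smul, smul_eq_mul,
    coeffFunctional_X_mul, coeffFunctional_derivative] at h
  simp only [← coeffFunctional_genPoly]
  rw [coeffFunctional_add, mul_add, h]
  simp only [← coeffFunctional_mul, ← coeffFunctional_add, ← coeffFunctional_sub]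
  congr 2
  funext j
  rcases j with _ | j
  · simp; ring
  · simp; ring

lemma sum_kern_mul_kern {ι : Type*} [Fintype ι] [DecidableEq ι] (a b : ℕ → ℝ)
    (X : Finset (Finset ι)) :
    ∑ x ∈ X, ∑ y ∈ X, kern a x y * kern b x y =
      ∑ S : Finset ι, ∑ T : Finset ι,
        a S.card * b T.card * (∑ x ∈ X, biasedProd S x * biasedProd T x) ^ 2 := by
  have h1 : ∀ x y : Finset ι, kern a x y * kern b x y = ∑ S : Finset ι, ∑ T : Finset ι,
      a S.card * b T.card *
        ((biasedProd S x * biasedProd T x) * (biasedProd S y * biasedProd T y)) := by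
    intro x y
    rw [kern, kern, sum_mul_sum]
    refine sum_congr rfl fun S _ => sum_congr rfl fun T _ => by ring
  have h2 : ∀ x ∈ X, ∑ y ∈ X, kern a x y * kern b x y = ∑ S : Finset ι, ∑ T : Finset ι,
      ∑ y ∈ X, a S.card * b T.card *
        ((biasedProd S x * biasedProd T x) * (biasedProd S y * biasedProd T y)) := by
    intro x _
    simp only [h1]
    rw [sum_comm]
    exact sum_congr rfl fun S _ => sum_comm
  rw [sum_congr rfl h2, sum_comm]
  refine sum_congr rfl fun S _ => ?_
  rw [sum_comm]
  refine sum_congr rfl fun T _ => ?_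
  rw [sq, sum_mul_sum, mul_sum]
  exact sum_congr rfl fun x _ => (mul_sum _ _ _).symm

lemma kern_sub {ι : Type*} [Fintype ι] [DecidableEq ι] (a b : ℕ → ℝ) (r : ℝ) (x y : Finset ι) :
    kern (fun k => a k - r * b k) x y = kern a x y - r * kern b x y := by
  simp only [kern, mul_sum, ← sum_sub_distrib]
  exact sum_congr rfl fun T _ => by ring

lemma kern_self_eq {ι : Type*} [Fintype ι] [DecidableEq ι] (a : ℕ → ℝ) (x y : Finset ι)
    (h : x.card = y.card) : kern a x x = kern a y y := by
  have key : ∀ x : Finset ι, genPoly x x = (1 + Polynomial.C 9 * Polynomial.X) ^ x.card *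
      (1 + Polynomial.C (1 / 9) * Polynomial.X) ^ (Fintype.card ι - x.card) := by
    intro x
    have h1 : ∀ i, (1 + Polynomial.C (biasedChar x i * biasedChar x i) * Polynomial.X) =
        if i ∈ x then (1 + Polynomial.C (9 : ℝ) * Polynomial.X)
          else (1 + Polynomial.C (1 / 9 : ℝ) * Polynomial.X) := by
      intro i; unfold biasedChar; split_ifs <;> norm_num
    rw [genPoly, prod_congr rfl fun i _ => h1 i, prod_ite, prod_const, prod_const]
    have h2 : univ.filter (fun i => i ∈ x) = x := by ext; simp
    have h3 : univ.filter (fun i => i ∉ x) = xᶜ := by ext; simp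
    rw [h2, h3, card_compl]
  rw [← coeffFunctional_genPoly, ← coeffFunctional_genPoly, key, key, h]

/-- Sum of the squared kernel over a set. -/
noncomputable def energy {ι : Type*} [Fintype ι] [DecidableEq ι] (g : ℕ → ℝ)
    (X : Finset (Finset ι)) : ℝ :=
  ∑ x ∈ X, ∑ y ∈ X, kern g x y * kern g x y

lemma energy_pos {ι : Type*} [Fintype ι] [DecidableEq ι] (g : ℕ → ℝ) (hg : ∀ k, 0 ≤ g k)
    (h0 : 0 < g 0) (X : Finset (Finset ι)) (hX : X.Nonempty) : 0 < energy g X := by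
  rw [energy, sum_kern_mul_kern]
  refine sum_pos' (fun S _ => sum_nonneg fun T _ => ?_) ⟨∅, mem_univ _, ?_⟩
  · exact mul_nonneg (mul_nonneg (hg _) (hg _)) (sq_nonneg _)
  refine sum_pos' (fun T _ => ?_) ⟨∅, mem_univ _, ?_⟩
  · exact mul_nonneg (mul_nonneg (hg _) (hg _)) (sq_nonneg _)
  have : 0 < (X.card : ℝ) := by exact_mod_cast hX.card_pos
  simp only [card_empty, biasedProd, prod_empty, mul_one, sum_const, nsmul_eq_mul]
  positivity

/-- Spectral inequality on a subset of a shell. -/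
lemma spectral_le {ι : Type*} [Fintype ι] [DecidableEq ι] (a : ℕ → ℝ) (L : ℝ)
    (ha : ∀ k, 0 ≤ a k)
    (hE : ∀ j, j ≤ Fintype.card ι → L * (a j + a (j + 1)) ≤ j * (a (j - 1) + a j) +
      (Fintype.card ι - j) * (a (j + 1) + a (j + 2)) + 64 / 9 * (j * (a j - a (j + 1))))
    (X : Finset (Finset ι)) (hX : ∀ x ∈ X, 10 * x.card = Fintype.card ι) :
    L * energy (fun k => a k + a (k + 1)) X ≤
      ∑ x ∈ X, ∑ y ∈ X, (∑ i, biasedChar x i * biasedChar y i) *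
        (kern (fun k => a k + a (k + 1)) x y * kern (fun k => a k + a (k + 1)) x y) := by
  rw [energy, mul_sum, ← sub_nonneg, ← sum_sub_distrib]
  have : ∀ x ∈ X, ∑ y ∈ X, (∑ i, biasedChar x i * biasedChar y i) *
        (kern (fun k => a k + a (k + 1)) x y * kern (fun k => a k + a (k + 1)) x y) -
      L * ∑ y ∈ X, kern (fun k => a k + a (k + 1)) x y * kern (fun k => a k + a (k + 1)) x y =
      ∑ y ∈ X, kern (fun j => (j * (a (j - 1) + a j) +
      (Fintype.card ι - j) * (a (j + 1) + a (j + 2)) + 64 / 9 * (j * (a j - a (j + 1)))) -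
        L * (a j + a (j + 1))) x y * kern (fun k => a k + a (k + 1)) x y := by
    intro x hx
    rw [mul_sum, ← sum_sub_distrib]
    refine sum_congr rfl fun y hy => ?_
    rw [kern_sub, ← dist_mul_kern a x y (hX x hx) (hX y hy)]
    ring
  rw [sum_congr rfl this, sum_kern_mul_kern]
  refine sum_nonneg fun S _ => sum_nonneg fun T _ => ?_
  refine mul_nonneg (mul_nonneg ?_ (add_nonneg (ha _) (ha _))) (sq_nonneg _)
  exact sub_nonneg.2 (hE _ (card_le_univ S))

/-- The diagonal value is controlled by the energy of the shell. -/
lemma diag_le {ι : Type*} [Fintype ι] [DecidableEq ι] (g : ℕ → ℝ) (hg : ∀ k, 0 ≤ g k) (t : ℕ)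
    (ht : ∀ k, t < k → g k = 0) (X : Finset (Finset ι)) :
    (∑ x ∈ X, kern g x x) ^ 2 ≤ (univ.filter fun T : Finset ι => T.card ≤ t).card * energy g X := by
  have h1 : ∑ x ∈ X, kern g x x = ∑ T ∈ univ.filter fun T : Finset ι => T.card ≤ t,
      g T.card * ∑ x ∈ X, biasedProd T x * biasedProd T x := by
    simp only [kern]
    rw [sum_comm, sum_filter]
    refine sum_congr rfl fun T _ => ?_
    split_ifs with h
    · rw [mul_sum]
    · simp [ht _ (not_le.1 h)]
  have h2 : ∑ T ∈ univ.filter fun T : Finset ι => T.card ≤ t,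
      (g T.card * ∑ x ∈ X, biasedProd T x * biasedProd T x) ^ 2 ≤ energy g X := by
    rw [energy, sum_kern_mul_kern]
    refine (sum_le_univ_sum_of_nonneg fun T => sq_nonneg _).trans (sum_le_sum fun S _ => ?_)
    refine le_trans (le_of_eq ?_) (single_le_sum (f := fun T : Finset ι => g S.card * g T.card *
      (∑ x ∈ X, biasedProd S x * biasedProd T x) ^ 2) (fun T _ => ?_) (mem_univ S))
    · ring
    · exact mul_nonneg (mul_nonneg (hg _) (hg _)) (sq_nonneg _)
  rw [h1]
  exact sq_sum_le_card_mul_sum_sq.trans (mul_le_mul_of_nonneg_left h2 (by positivity))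

open scoped symmDiff

/-- The translates of the words of `A` by `z` that lie in the shell `Y`. -/
def shellTranslate {ι : Type*} [DecidableEq ι] (A Y : Finset (Finset ι)) (z : Finset ι) :
    Finset (Finset ι) := Y.filter fun x => x ∆ z ∈ A

lemma sum_shellTranslate {ι : Type*} [Fintype ι] [DecidableEq ι] (A Y : Finset (Finset ι))
    (f : Finset ι → ℝ) :
    ∑ z, ∑ x ∈ shellTranslate A Y z, f x = A.card * ∑ x ∈ Y, f x := by
  simp only [shellTranslate, sum_filter]
  rw [sum_comm, mul_sum]
  refine sum_congr rfl fun x _ => ?_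
  rw [← Equiv.sum_comp (symmDiff_right_involutive x).toPerm]
  simp

lemma energy_shellTranslate {ι : Type*} [Fintype ι] [DecidableEq ι] (g : ℕ → ℝ) (hg : ∀ k, 0 ≤ g k)
    (A Y : Finset (Finset ι)) :
    (A.card : ℝ) ^ 2 * energy g Y ≤ 2 ^ Fintype.card ι * ∑ z, energy g (shellTranslate A Y z) := by
  have hc : ∀ F : Finset ι → Finset ι → Finset ι → ℝ,
      ∑ z, ∑ S, ∑ T, F z S T = ∑ S, ∑ T, ∑ z, F z S T := fun F => by
    rw [sum_comm]; exact sum_congr rfl fun S _ => sum_comm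
  simp only [energy, sum_kern_mul_kern]
  rw [hc]
  simp only [mul_sum]
  refine sum_le_sum fun S _ => sum_le_sum fun T _ => ?_
  simp only [← mul_sum]
  have h := sq_sum_le_card_mul_sum_sq (s := (univ : Finset (Finset ι)))
    (f := fun z => ∑ x ∈ shellTranslate A Y z, biasedProd S x * biasedProd T x)
  rw [sum_shellTranslate, mul_pow, card_univ, Fintype.card_finset] at h
  push_cast at h
  have := mul_le_mul_of_nonneg_left h (mul_nonneg (hg S.card) (hg T.card))
  linarith

/-- Differences of distinct members of the family determine the pair. -/
def IsSidonFamily {ι : Type*} [DecidableEq ι] (A : Finset (Finset ι)) : Prop :=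
  ∀ a ∈ A, ∀ b ∈ A, ∀ c ∈ A, ∀ d ∈ A, a ≠ b → a \ b = c \ d → b \ a = d \ c → a = c

lemma card_common_translate {ι : Type*} [Fintype ι] [DecidableEq ι] {A : Finset (Finset ι)}
    (hA : IsSidonFamily A) (x y : Finset ι) (hxy : x ≠ y) :
    (univ.filter fun z => x ∆ z ∈ A ∧ y ∆ z ∈ A).card ≤ 2 ^ (x ∆ y).card := by
  rw [← card_powerset]
  refine card_le_card_of_injOn (fun z => (x ∆ z) \ (y ∆ z)) (fun z _ => ?_) fun z hz z' hz' h => ?_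
  · simp only [coe_powerset, Set.mem_preimage, Set.mem_powerset_iff, coe_subset]
    intro i
    simp only [mem_sdiff, mem_symmDiff]
    tauto
  · simp only [coe_filter, mem_univ, true_and, Set.mem_ofPred_eq] at hz hz'
    have h2 : (y ∆ z) \ (x ∆ z) = (y ∆ z') \ (x ∆ z') := by
      have key : ∀ z : Finset ι, (y ∆ z) \ (x ∆ z) = (x ∆ y) \ ((x ∆ z) \ (y ∆ z)) := by
        intro z
        ext i
        by_cases hx : i ∈ x <;> by_cases hy : i ∈ y <;> by_cases hz : i ∈ z <;>
          simp [mem_symmDiff, hx, hy, hz]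
      rw [key, key]
      exact congrArg _ h
    have := hA _ hz.1 _ hz.2 _ hz'.1 _ hz'.2 (fun e => hxy (symmDiff_left_injective z e)) h h2
    exact symmDiff_right_injective x this

lemma sum_pairs_shellTranslate {ι : Type*} [Fintype ι] [DecidableEq ι]
    (A Y : Finset (Finset ι)) (f : Finset ι → Finset ι → ℝ) :
    ∑ z, ∑ x ∈ shellTranslate A Y z, ∑ y ∈ shellTranslate A Y z, f x y =
      ∑ x ∈ Y, ∑ y ∈ Y, (univ.filter fun z => x ∆ z ∈ A ∧ y ∆ z ∈ A).card * f x y := by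
  simp only [shellTranslate, sum_filter]
  rw [sum_comm]
  refine sum_congr rfl fun x _ => ?_
  have h : ∀ z, (if x ∆ z ∈ A then ∑ y ∈ Y, (if y ∆ z ∈ A then f x y else 0) else 0) =
      ∑ y ∈ Y, if x ∆ z ∈ A ∧ y ∆ z ∈ A then f x y else 0 := by
    intro z
    split_ifs with h <;> simp [h]
  rw [sum_congr rfl fun z _ => h z, sum_comm]
  refine sum_congr rfl fun y _ => ?_
  rw [← sum_filter, sum_const, nsmul_eq_mul]

lemma offDiag_le {ι : Type*} [Fintype ι] [DecidableEq ι] (g : ℕ → ℝ) {A : Finset (Finset ι)}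
    (hA : IsSidonFamily A) (Y : Finset (Finset ι)) (D : ℕ) :
    ∑ z, ∑ x ∈ shellTranslate A Y z, ∑ y ∈ shellTranslate A Y z,
      (if x ≠ y ∧ (x ∆ y).card ≤ D then kern g x y * kern g x y else 0) ≤ 2 ^ D * energy g Y := by
  simp only [sum_pairs_shellTranslate, energy, mul_sum]
  refine sum_le_sum fun x _ => sum_le_sum fun y _ => ?_
  split_ifs with hxy
  · refine mul_le_mul_of_nonneg_right ?_ (mul_self_nonneg _)
    have := (card_common_translate hA x y hxy.1).trans (Nat.pow_le_pow_right two_pos hxy.2)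
    exact_mod_cast this
  · simp only [mul_zero]
    exact mul_nonneg (by positivity) (mul_self_nonneg _)

/-- The main inequality for families with distinct differences. -/
lemma sidon_inequality {ι : Type*} [Fintype ι] [DecidableEq ι] (a : ℕ → ℝ) (L : ℝ) (t w D : ℕ)
    (hw : 10 * w = Fintype.card ι) (ha : ∀ k, 0 ≤ a k) (ha0 : 0 < a 0) (ht : ∀ k, t < k → a k = 0)
    (hE : ∀ j, j ≤ Fintype.card ι → L * (a j + a (j + 1)) ≤ j * (a (j - 1) + a j) +
      (Fintype.card ι - j) * (a (j + 1) + a (j + 2)) + 64 / 9 * (j * (a j - a (j + 1))))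
    {A : Finset (Finset ι)} (hA : IsSidonFamily A) :
    (L - (Fintype.card ι - 50 / 9 * D)) * (A.card : ℝ) ^ 2 * (Fintype.card ι).choose w ≤
      2 ^ Fintype.card ι * (50 / 9 * D) * (A.card * (univ.filter fun T : Finset ι => T.card ≤ t).card
        + 2 ^ D * (Fintype.card ι).choose w) := by
  set n := Fintype.card ι with hn
  set g : ℕ → ℝ := fun k => a k + a (k + 1) with hg
  set Y : Finset (Finset ι) := powersetCard w univ with hY
  have hYc : Y.card = n.choose w := by simp [hY, hn]
  have hYm : ∀ x ∈ Y, x.card = w := fun x hx => (mem_powersetCard.1 hx).2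
  have hNpos : 0 < n.choose w := Nat.choose_pos (by omega)
  have hYne : Y.Nonempty := card_pos.1 (hYc ▸ hNpos)
  have hg0 : ∀ k, 0 ≤ g k := fun k => add_nonneg (ha _) (ha _)
  have hW : 0 < energy g Y :=
    energy_pos g hg0 (add_pos_of_pos_of_nonneg ha0 (ha _)) Y hYne
  obtain ⟨x₀, hx₀⟩ := hYne
  set G := kern g x₀ x₀ with hG
  have hGx : ∀ x ∈ Y, kern g x x = G := fun x hx =>
    kern_self_eq g x x₀ ((hYm x hx).trans (hYm _ hx₀).symm)
  have hdiag : (n.choose w * G) ^ 2 ≤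
      (univ.filter fun T : Finset ι => T.card ≤ t).card * energy g Y := by
    have := diag_le g hg0 t (fun k hk => by simp [hg, ht k hk, ht (k + 1) (by omega)]) Y
    rwa [sum_congr rfl hGx, sum_const, nsmul_eq_mul, hYc] at this
  have hsub : ∀ z, shellTranslate A Y z ⊆ Y := fun z => filter_subset _ _
  have h1 : ∀ z, (L - (n - 50 / 9 * D)) * energy g (shellTranslate A Y z) ≤
      50 / 9 * D * (∑ x ∈ shellTranslate A Y z, G ^ 2) + 50 / 9 * D *
      ∑ x ∈ shellTranslate A Y z, ∑ y ∈ shellTranslate A Y z,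
      (if x ≠ y ∧ (x ∆ y).card ≤ D then kern g x y * kern g x y else 0) := by
    intro z
    have hs := spectral_le a L ha hE (shellTranslate A Y z)
      (fun x hx => by rw [hYm x (hsub z hx), hw])
    rw [sub_mul]
    refine (sub_le_sub_right hs _).trans ?_
    rw [energy, mul_sum, mul_sum, mul_sum, ← sum_sub_distrib, ← sum_add_distrib]
    refine sum_le_sum fun x hx => ?_
    have hd : 50 / 9 * (D : ℝ) * G ^ 2 = ∑ y ∈ shellTranslate A Y z,
        if x = y then 50 / 9 * (D : ℝ) * G ^ 2 else 0 := by
      rw [sum_ite_eq, if_pos hx]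
    rw [hd, mul_sum, mul_sum, ← sum_sub_distrib, ← sum_add_distrib]
    refine sum_le_sum fun y hy => ?_
    have hx1 := hYm x (hsub z hx)
    have hy1 := hYm y (hsub z hy)
    rw [sum_biasedChar_mul x y (by rw [hx1, hw]) (by rw [hy1, hw]), ← hn]
    by_cases hxy : x = y
    · subst hxy
      rw [hGx x (hsub z hx)]
      simp
      linarith
    · rw [if_neg hxy]
      have hK := mul_self_nonneg (kern g x y)
      have hc0 : (0 : ℝ) ≤ ((x ∆ y).card : ℝ) := by positivity
      split_ifs with h2
      · nlinarith [mul_nonneg hc0 hK]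
      · have h3 : (D : ℝ) ≤ ((x ∆ y).card : ℝ) := by
          have : ¬ (x ∆ y).card ≤ D := fun h => h2 ⟨hxy, h⟩
          exact_mod_cast (not_le.1 this).le
        nlinarith [mul_nonneg (sub_nonneg.2 h3) hK]
  have h2 : (L - (n - 50 / 9 * D)) * ∑ z, energy g (shellTranslate A Y z) ≤
      50 / 9 * D * (A.card * (n.choose w * G ^ 2)) + 50 / 9 * D * (2 ^ D * energy g Y) := by
    rw [mul_sum]
    refine (sum_le_sum fun z _ => h1 z).trans ?_
    rw [sum_add_distrib, ← mul_sum, ← mul_sum, sum_shellTranslate, sum_const, nsmul_eq_mul, hYc]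
    gcongr
    exact offDiag_le g hA Y D
  by_cases hL : L - (n - 50 / 9 * D) ≤ 0
  · refine le_trans (mul_nonpos_of_nonpos_of_nonneg
      (mul_nonpos_of_nonpos_of_nonneg hL (by positivity)) (by positivity)) (by positivity)
  have h3 := mul_le_mul_of_nonneg_left (energy_shellTranslate g hg0 A Y) (not_le.1 hL).le
  rw [← hn] at h3
  have hN : (0 : ℝ) < n.choose w := by exact_mod_cast hNpos
  have h4 := mul_le_mul_of_nonneg_left h2 (by positivity : (0 : ℝ) ≤ 2 ^ n * n.choose w)
  have h5 := mul_le_mul_of_nonneg_left hdiag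
    (by positivity : (0 : ℝ) ≤ 2 ^ n * (50 / 9 * D) * A.card)
  refine le_of_mul_le_mul_right ?_ hW
  have h6 := mul_le_mul_of_nonneg_left h3 hN.le
  linarith

/-- A positive supersolution of the degree recurrence, read from the top degree downwards. -/
noncomputable def profile : ℕ → ℝ
  | 0 => 0
  | 1 => 0
  | 2 => 10
  | 3 => 263
  | 4 => 5249
  | 5 => 92168
  | 6 => 1495630
  | 7 => 22906961
  | 8 => 334470299
  | 9 => 4675340965
  | 10 => 62572289037
  | 11 => 798652492812
  | 12 => 9628925980433
  | 13 => 107465423355367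
  | 14 => 1059942028054876
  | (k + 15) => 8018960385130964 * (200 / 33) ^ k

lemma profile_nonneg (k : ℕ) : 0 ≤ profile k := by
  unfold profile
  split <;> positivity

lemma profile_le_succ (k : ℕ) : profile k ≤ profile (k + 1) := by
  by_cases hk : k ≤ 14
  · interval_cases k <;> norm_num [profile]
  · obtain ⟨m, rfl⟩ : ∃ m, k = m + 15 := ⟨k - 15, by omega⟩
    rw [show m + 15 + 1 = (m + 1) + 15 by ring]
    simp only [profile, pow_succ]
    have : (0 : ℝ) ≤ (200 / 33) ^ m := by positivity
    linarith

lemma profile_ineq (N : ℝ) (hN : 0 ≤ N) (i : ℕ) (j : ℝ) (hj0 : 0 ≤ j) (hj : i ≤ 14 → 6 * N ≤ j) :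
    33 / 200 * (1250 * N) * (profile (i + 2) + profile (i + 1)) ≤
      j * (profile (i + 3) + profile (i + 2)) +
      (1250 * N - j) * (profile (i + 1) + profile i) +
      64 / 9 * (j * (profile (i + 2) - profile (i + 1))) := by
  have h0 := profile_le_succ i
  have h1 := profile_le_succ (i + 1)
  have h2 := profile_le_succ (i + 2)
  set X := profile (i + 3) + profile (i + 2) - profile (i + 1) - profile i +
    64 / 9 * (profile (i + 2) - profile (i + 1)) with hX
  have hX0 : 0 ≤ X := by rw [hX]; linarith
  suffices h : 33 / 200 * (1250 * N) * (profile (i + 2) + profile (i + 1)) ≤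
      1250 * N * (profile (i + 1) + profile i) + j * X by
    rw [hX] at h; linarith
  by_cases hi : i ≤ 14
  · have h3 := mul_le_mul_of_nonneg_right (hj hi) hX0
    suffices h : 33 / 200 * 1250 * (profile (i + 2) + profile (i + 1)) ≤
        1250 * (profile (i + 1) + profile i) + 6 * X by
      have := mul_le_mul_of_nonneg_left h hN
      linarith
    rw [hX]
    clear hX hX0 h0 h1 h2 h3 hj X
    interval_cases i <;> norm_num [profile]
  · obtain ⟨m, rfl⟩ : ∃ m, i = m + 15 := ⟨i - 15, by omega⟩
    have h3 : 33 / 200 * (1250 * N) * (profile (m + 15 + 2) + profile (m + 15 + 1)) =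
        1250 * N * (profile (m + 15 + 1) + profile (m + 15)) := by
      rw [show m + 15 + 1 = (m + 1) + 15 by ring, show m + 15 + 2 = (m + 2) + 15 by ring]
      simp only [profile, pow_succ]
      ring
    rw [h3]
    linarith [mul_nonneg hj0 hX0]

lemma sidon_card_sq_le {ι : Type*} [Fintype ι] [DecidableEq ι] (N : ℕ) (hN : 0 < N)
    (hι : Fintype.card ι = 1250 * N) {A : Finset (Finset ι)} (hA : IsSidonFamily A) :
    (A.card : ℝ) ^ 2 * (1250 * N).choose (125 * N) ≤
      1504 * 2 ^ (1250 * N) * (A.card * (univ.filter fun T : Finset ι => T.card ≤ 6 * N + 14).card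
        + 2 ^ (188 * N) * (1250 * N).choose (125 * N)) := by
  have hN' : (0 : ℝ) < N := by exact_mod_cast hN
  have h := sidon_inequality (ι := ι) (fun k => profile (6 * N + 16 - k)) (33 / 200 * (1250 * N))
    (6 * N + 14) (125 * N) (188 * N) (by rw [hι]; ring) (fun k => profile_nonneg _) ?_ ?_ ?_ hA
  · rw [hι] at h
    push_cast at h
    have h2 : (N : ℝ) * ((A.card : ℝ) ^ 2 * (1250 * N).choose (125 * N)) ≤
      N * (1504 * 2 ^ (1250 * N) * (A.card * (univ.filter fun T : Finset ι => T.card ≤ 6 * N + 14).card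
        + 2 ^ (188 * N) * (1250 * N).choose (125 * N))) := by linarith
    exact le_of_mul_le_mul_left h2 hN'
  · obtain ⟨m, hm⟩ : ∃ m, 6 * N + 16 = m + 15 := ⟨6 * N + 1, by ring⟩
    simp only [Nat.sub_zero, hm, profile]
    positivity
  · intro k hk
    have : 6 * N + 16 - k = 0 ∨ 6 * N + 16 - k = 1 := by omega
    rcases this with h | h <;> simp [h, profile]
  · intro j hj
    rw [hι, Nat.cast_mul, Nat.cast_ofNat]
    by_cases hjT : j ≤ 6 * N + 14
    · obtain ⟨i, hi⟩ : ∃ i, 6 * N + 14 = j + i := ⟨6 * N + 14 - j, by omega⟩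
      have h := profile_ineq N hN'.le i j (by positivity)
        (fun h14 => by exact_mod_cast (by omega : 6 * N ≤ j))
      have e0 : 6 * N + 16 - j = i + 2 := by omega
      have e1 : 6 * N + 16 - (j + 1) = i + 1 := by omega
      have e2 : 6 * N + 16 - (j + 2) = i := by omega
      rw [e0, e1, e2]
      rcases j with _ | j
      · simp only [Nat.cast_zero, zero_mul, sub_zero, mul_zero, zero_add, add_zero] at h ⊢
        exact h
      · have e3 : 6 * N + 16 - (j + 1 - 1) = i + 3 := by omega
        rw [e3]
        exact h
    · have e0 : profile (6 * N + 16 - j) = 0 := by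
        have : 6 * N + 16 - j = 0 ∨ 6 * N + 16 - j = 1 := by omega
        rcases this with h | h <;> simp [h, profile]
      have e1 : 6 * N + 16 - (j + 1) = 0 := by omega
      have e2 : 6 * N + 16 - (j + 2) = 0 := by omega
      rw [e0, e1, e2, show profile 0 = 0 from rfl]
      have := profile_nonneg (6 * N + 16 - (j - 1))
      have hj' : (0 : ℝ) ≤ j := by positivity
      nlinarith [mul_nonneg hj' this]

lemma card_filter_card_le {ι : Type*} [Fintype ι] [DecidableEq ι] (t : ℕ) (z : ℝ) (hz : 0 < z)
    (hz1 : z ≤ 1) :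
    ((univ.filter fun T : Finset ι => T.card ≤ t).card : ℝ) * z ^ t ≤ (1 + z) ^ Fintype.card ι := by
  have h : (1 + z) ^ Fintype.card ι = ∑ T : Finset ι, z ^ T.card := by
    have := Finset.prod_one_add (f := fun _ : ι => z) univ
    simpa using this
  rw [h, ← nsmul_eq_mul, ← sum_const]
  refine (sum_le_sum fun T hT => ?_).trans (sum_le_univ_sum_of_nonneg fun T => by positivity)
  exact pow_le_pow_of_le_one hz.le hz1 (mem_filter.1 hT).2

lemma ten_pow_le_choose (w : ℕ) :
    10 ^ (10 * w) ≤ (10 * w + 1) * ((10 * w).choose w * 9 ^ (9 * w)) := by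
  set f : ℕ → ℕ := fun k => (10 * w).choose k * 9 ^ (10 * w - k) with hf
  have hstep : ∀ k < 10 * w, f (k + 1) * ((k + 1) * 9) = f k * (10 * w - k) := by
    intro k hk
    have h1 := Nat.choose_succ_right_eq (10 * w) k
    simp only [hf]
    have h2 : 10 * w - k = (10 * w - (k + 1)) + 1 := by omega
    calc (10 * w).choose (k + 1) * 9 ^ (10 * w - (k + 1)) * ((k + 1) * 9)
        = ((10 * w).choose (k + 1) * (k + 1)) * 9 ^ ((10 * w - (k + 1)) + 1) := by ring
      _ = _ := by rw [h1, ← h2]; ring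
  have hdown : ∀ k, w ≤ k → k ≤ 10 * w → f k ≤ f w := by
    intro k hk
    induction k, hk using Nat.le_induction with
    | base => intro _; exact le_rfl
    | succ k hk ih =>
      intro hk2
      refine le_trans ?_ (ih (by omega))
      have h := hstep k (by omega)
      have h3 : 10 * w - k ≤ (k + 1) * 9 := by omega
      have h4 : f (k + 1) * ((k + 1) * 9) ≤ f k * ((k + 1) * 9) :=
        h ▸ Nat.mul_le_mul_left _ h3
      exact Nat.le_of_mul_le_mul_right h4 (by omega)
  have hup : ∀ d ≤ w, f (w - d) ≤ f w := by
    intro d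
    induction d with
    | zero => intro _; exact le_rfl
    | succ d ih =>
      intro hd
      refine le_trans ?_ (ih (by omega))
      have h := hstep (w - (d + 1)) (by omega)
      rw [show w - (d + 1) + 1 = w - d by omega] at h
      have h3 : (w - d) * 9 ≤ 10 * w - (w - (d + 1)) := by omega
      have h4 : f (w - (d + 1)) * (10 * w - (w - (d + 1))) ≤ f (w - d) * (10 * w - (w - (d + 1))) :=
        h ▸ Nat.mul_le_mul_left _ h3
      exact Nat.le_of_mul_le_mul_right h4 (by omega)
  have hall : ∀ k ∈ range (10 * w + 1), f k ≤ f w := by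
    intro k hk
    rw [mem_range] at hk
    rcases le_total w k with h | h
    · exact hdown k h (by omega)
    · have := hup (w - k) (by omega)
      rwa [show w - (w - k) = k by omega] at this
  have hsum : 10 ^ (10 * w) = ∑ k ∈ range (10 * w + 1), f k := by
    have := add_pow 1 9 (10 * w)
    norm_num at this
    rw [this]
    exact sum_congr rfl fun k _ => by simp only [hf]; ring
  rw [hsum]
  refine (sum_le_card_nsmul _ _ _ hall).trans ?_
  simp only [card_range, smul_eq_mul, hf]
  rw [show 10 * w - w = 9 * w by omega]

set_option exponentiation.threshold 2000 in
lemma sidon_rate_numeric :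
    (2 : ℝ) ^ 531 * 625 ^ 1250 * 9 ^ 1125 ≤ 3 ^ 6 * 622 ^ 1244 * 10 ^ 1250 := by
  norm_num

lemma sidon_card_le {ι : Type*} [Fintype ι] [DecidableEq ι] (N : ℕ) (hN : 0 < N)
    (hι : Fintype.card ι = 1250 * N) {A : Finset (Finset ι)} (hA : IsSidonFamily A) :
    (A.card : ℝ) ≤ 3008 * (622 / 3) ^ 14 * (1250 * N + 1) * 2 ^ (719 * N) := by
  have h := sidon_card_sq_le N hN hι hA
  set M : ℝ := (A.card : ℝ) with hM
  set B : ℝ := ((univ.filter fun T : Finset ι => T.card ≤ 6 * N + 14).card : ℝ) with hB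
  set S : ℝ := ((1250 * N).choose (125 * N) : ℝ) with hS
  have hM0 : 0 ≤ M := by positivity
  have hS0 : 0 < S := by
    rw [hS]; exact_mod_cast Nat.choose_pos (by omega)
  have hNN : (1 : ℝ) ≤ 1250 * N + 1 := by
    have : (0 : ℝ) ≤ N := by positivity
    linarith
  have hK : (3008 : ℝ) ≤ 3008 * (622 / 3) ^ 14 * (1250 * N + 1) := by
    have : (1 : ℝ) ≤ (622 / 3) ^ 14 := one_le_pow₀ (by norm_num)
    nlinarith
  rcases le_total (M * B) (2 ^ (188 * N) * S) with hc | hc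
  · have h1 : M ^ 2 * S ≤ (3008 * 2 ^ (1438 * N)) * S := by
      have e : (2 : ℝ) ^ (1438 * N) = 2 ^ (1250 * N) * 2 ^ (188 * N) := by
        rw [← pow_add]; congr 1; ring
      rw [e]
      have := mul_le_mul_of_nonneg_left hc (by positivity : (0 : ℝ) ≤ 1504 * 2 ^ (1250 * N))
      linarith
    have h2 := le_of_mul_le_mul_right h1 hS0
    have h3 : M ^ 2 ≤ (3008 * 2 ^ (719 * N)) ^ 2 := by
      refine h2.trans ?_
      have e : (2 : ℝ) ^ (1438 * N) = (2 ^ (719 * N)) ^ 2 := by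
        rw [← pow_mul]; congr 1; ring
      rw [mul_pow, e]
      have : (0 : ℝ) ≤ (2 ^ (719 * N)) ^ 2 := by positivity
      nlinarith
    have h4 := le_of_sq_le_sq h3 (by positivity)
    exact h4.trans (mul_le_mul_of_nonneg_right hK (by positivity))
  · have h1 : M * (M * S) ≤ M * (3008 * 2 ^ (1250 * N) * B) := by
      have := mul_le_mul_of_nonneg_left hc (by positivity : (0 : ℝ) ≤ 1504 * 2 ^ (1250 * N))
      linarith
    rcases hM0.eq_or_lt with h0 | h0
    · rw [← h0]; positivity
    have h2 := le_of_mul_le_mul_left h1 h0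
    have hB1 := card_filter_card_le (ι := ι) (6 * N + 14) (3 / 622) (by norm_num) (by norm_num)
    rw [← hB, hι] at hB1
    have hB2 : B ≤ (622 / 3) ^ (6 * N + 14) * (625 / 622) ^ (1250 * N) := by
      have := mul_le_mul_of_nonneg_left hB1
        (by positivity : (0 : ℝ) ≤ (622 / 3) ^ (6 * N + 14))
      have e : (622 / 3 : ℝ) ^ (6 * N + 14) * (B * (3 / 622) ^ (6 * N + 14)) = B := by
        have : (622 / 3 : ℝ) ^ (6 * N + 14) * (3 / 622) ^ (6 * N + 14) = 1 := by
          rw [← mul_pow]; norm_num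
        linear_combination B * this
      rw [e] at this
      rwa [show (1 + 3 / 622 : ℝ) = 625 / 622 by norm_num] at this
    have hS1 : (10 : ℝ) ^ (1250 * N) ≤ (1250 * N + 1) * (S * 9 ^ (1125 * N)) := by
      have := ten_pow_le_choose (125 * N)
      rw [show 10 * (125 * N) = 1250 * N by ring, show 9 * (125 * N) = 1125 * N by ring] at this
      rw [hS]
      exact_mod_cast this
    have hnum2 : (2 : ℝ) ^ (1250 * N) * ((622 / 3) ^ (6 * N) * (625 / 622) ^ (1250 * N)) *
        9 ^ (1125 * N) ≤ 2 ^ (719 * N) * 10 ^ (1250 * N) := by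
      simp only [pow_mul, ← mul_pow]
      refine pow_le_pow_left₀ (by positivity) ?_ N
      rw [div_pow, div_pow]
      have e : (2 : ℝ) ^ 1250 * (622 ^ 6 / 3 ^ 6 * (625 ^ 1250 / 622 ^ 1250)) * 9 ^ 1125 =
          2 ^ 719 * ((2 ^ 531 * 625 ^ 1250 * 9 ^ 1125) / (3 ^ 6 * 622 ^ 1244)) := by
        have e1 : (622 : ℝ) ^ 1250 = 622 ^ 6 * 622 ^ 1244 := by rw [← pow_add]
        have e2 : (2 : ℝ) ^ 1250 = 2 ^ 719 * 2 ^ 531 := by rw [← pow_add]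
        rw [e1, e2]
        generalize (622 : ℝ) ^ 1244 = u
        generalize (625 : ℝ) ^ 1250 = v
        generalize (9 : ℝ) ^ 1125 = s
        generalize (2 : ℝ) ^ 719 = p
        generalize (2 : ℝ) ^ 531 = q
        field_simp
      rw [e]
      refine mul_le_mul_of_nonneg_left ?_ (by positivity)
      rw [div_le_iff₀ (by positivity)]
      exact sidon_rate_numeric.trans (le_of_eq (mul_comm _ _))
    have h10 : (0 : ℝ) < 10 ^ (1250 * N) := by positivity
    refine le_of_mul_le_mul_right ?_ h10
    calc M * 10 ^ (1250 * N) ≤ M * ((1250 * N + 1) * (S * 9 ^ (1125 * N))) := by gcongr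
      _ = (M * S) * ((1250 * N + 1) * 9 ^ (1125 * N)) := by ring
      _ ≤ (3008 * 2 ^ (1250 * N) * B) * ((1250 * N + 1) * 9 ^ (1125 * N)) := by gcongr
      _ ≤ (3008 * 2 ^ (1250 * N) * ((622 / 3) ^ (6 * N + 14) * (625 / 622) ^ (1250 * N))) *
          ((1250 * N + 1) * 9 ^ (1125 * N)) := by gcongr
      _ = 3008 * (622 / 3) ^ 14 * (1250 * N + 1) * (2 ^ (1250 * N) *
          ((622 / 3) ^ (6 * N) * (625 / 622) ^ (1250 * N)) * 9 ^ (1125 * N)) := by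
        rw [pow_add]; ring
      _ ≤ 3008 * (622 / 3) ^ 14 * (1250 * N + 1) * (2 ^ (719 * N) * 10 ^ (1250 * N)) := by gcongr
      _ = _ := by ring

lemma sum_mul_log_div_le {α : Type*} (s : Finset α) (p q : α → ℝ) (hp : ∀ x ∈ s, 0 < p x)
    (hq : ∀ x ∈ s, 0 < q x) :
    ∑ x ∈ s, p x * Real.log (q x / p x) ≤ ∑ x ∈ s, q x - ∑ x ∈ s, p x := by
  rw [← sum_sub_distrib]
  refine sum_le_sum fun x hx => ?_
  have h1 := hp x hx
  have h := Real.log_le_sub_one_of_pos (div_pos (hq x hx) h1)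
  calc p x * Real.log (q x / p x) ≤ p x * (q x / p x - 1) := mul_le_mul_of_nonneg_left h h1.le
    _ = q x - p x := by field_simp

/-- The members of `s` with the same key as `x`. -/
def keyClass {α κ : Type*} [DecidableEq κ] (s : Finset α) (k : α → κ) (x : α) : Finset α :=
  s.filter fun y => k y = k x

lemma keyClass_card_pos {α κ : Type*} [DecidableEq κ] {s : Finset α} {k : α → κ} {x : α}
    (hx : x ∈ s) : 0 < (keyClass s k x).card :=
  card_pos.2 ⟨x, mem_filter.2 ⟨hx, rfl⟩⟩

lemma sum_sum_keyClass {α κ : Type*} [DecidableEq κ] (s : Finset α) (k : α → κ)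
    (G : α → α → ℝ) :
    ∑ x ∈ s, (∑ y ∈ keyClass s k x, G x y) / (keyClass s k x).card =
      ∑ f ∈ s.image k, (∑ x ∈ s with k x = f, ∑ y ∈ s with k y = f, G x y) /
        (s.filter fun x => k x = f).card := by
  rw [← sum_fiberwise_of_maps_to (fun x hx => mem_image_of_mem k hx)]
  refine sum_congr rfl fun f _ => ?_
  rw [sum_div]
  refine sum_congr rfl fun x hx => ?_
  rw [← (mem_filter.1 hx).2]
  rfl

lemma sum_div_keyClass {α κ : Type*} [DecidableEq κ] (s : Finset α) (k : α → κ) (w : κ → ℝ) :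
    ∑ x ∈ s, w (k x) / (keyClass s k x).card = ∑ f ∈ s.image k, w f := by
  rw [← sum_fiberwise_of_maps_to (fun x hx => mem_image_of_mem k hx)]
  refine sum_congr rfl fun f hf => ?_
  have h : ∀ x ∈ s.filter (fun x => k x = f), w (k x) / (keyClass s k x).card =
      w f / (s.filter fun x => k x = f).card := by
    intro x hx
    rw [← (mem_filter.1 hx).2]
    rfl
  rw [sum_congr rfl h, sum_const, nsmul_eq_mul]
  obtain ⟨x, hx, rfl⟩ := mem_image.1 hf
  have : ((s.filter fun y => k y = k x).card : ℝ) ≠ 0 := by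
    exact_mod_cast (keyClass_card_pos (k := k) hx).ne'
  field_simp

lemma sum_sq_sub_keyClass_le {α κ : Type*} [DecidableEq κ] (s : Finset α) (k : α → κ)
    (h : α → ℝ) :
    ∑ x ∈ s, (∑ y ∈ keyClass s k x, (h x - h y) ^ 2) / (keyClass s k x).card ≤
      2 * ∑ x ∈ s, h x ^ 2 := by
  rw [sum_sum_keyClass, ← sum_fiberwise_of_maps_to (fun x hx => mem_image_of_mem k hx), mul_sum]
  refine sum_le_sum fun f hf => ?_
  obtain ⟨x, hx, rfl⟩ := mem_image.1 hf
  have hpos : (0 : ℝ) < (s.filter fun y => k y = k x).card := by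
    exact_mod_cast keyClass_card_pos (k := k) hx
  rw [div_le_iff₀ hpos]
  generalize s.filter (fun y => k y = k x) = u
  have e : ∑ x ∈ u, ∑ y ∈ u, (h x - h y) ^ 2 =
      2 * (∑ x ∈ u, h x ^ 2) * u.card - 2 * (∑ x ∈ u, h x) ^ 2 := by
    have : ∀ x y, (h x - h y) ^ 2 = h x ^ 2 + h y ^ 2 - 2 * (h x * h y) := fun x y => by ring
    simp only [this, sum_sub_distrib, sum_add_distrib, sum_const, nsmul_eq_mul, ← mul_sum]
    rw [← sum_mul]
    ring
  rw [e]
  nlinarith [sq_nonneg (∑ x ∈ u, h x)]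

/-- A ternary distribution coding the sum of two independent bits of bias `p` within
`1.52` bits. -/
lemma exists_ternary_code (p : ℝ) (h0 : 0 ≤ p) (h1 : p ≤ 1) :
    ∃ q : ℕ → ℝ, (∀ j, 0 < q j) ∧ q 0 + q 1 + q 2 = 1 ∧
      -(1.52 * Real.log 2) ≤ p ^ 2 * Real.log (q 2) + 2 * p * (1 - p) * Real.log (q 1) +
        (1 - p) ^ 2 * Real.log (q 0) := by
  have hl2 : 0 < Real.log 2 := Real.log_pos (by norm_num)
  have h25 : Real.log (5 / 2) ≤ 1.36 * Real.log 2 := by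
    have h : Real.log ((5 / 2 : ℝ) ^ 25) ≤ Real.log (2 ^ 34) :=
      Real.log_le_log (by norm_num) (by norm_num)
    rw [Real.log_pow, Real.log_pow] at h
    push_cast at h
    linarith
  have e25 : Real.log (2 / 5) = -Real.log (5 / 2) := by
    rw [← Real.log_inv]; norm_num
  have e15 : Real.log (1 / 5) = -Real.log (5 / 2) - Real.log 2 := by
    rw [← e25, ← Real.log_div (by norm_num) (by norm_num)]; norm_num
  rcases lt_or_ge p (2 / 5) with ha | ha
  · refine ⟨fun j => if j = 2 then 1 / 5 else 2 / 5, fun j => by positivity, by norm_num, ?_⟩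
    norm_num only [if_true, if_false]
    rw [e25, e15]
    nlinarith [mul_nonneg hl2.le (mul_nonneg (sub_nonneg.2 ha.le) (by linarith : 0 ≤ 2 / 5 + p))]
  rcases lt_or_ge (3 / 5) p with hb | hb
  · refine ⟨fun j => if j = 0 then 1 / 5 else 2 / 5, fun j => by positivity, by norm_num, ?_⟩
    norm_num only [if_true, if_false]
    rw [e25, e15]
    nlinarith [mul_nonneg hl2.le (mul_nonneg (sub_nonneg.2 hb.le) (by linarith : 0 ≤ 7 / 5 - p))]
  · refine ⟨fun j => if j = 1 then 1 / 2 else 1 / 4, fun j => by positivity, by norm_num, ?_⟩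
    norm_num only [if_true, if_false]
    have e2 : Real.log (1 / 2) = -Real.log 2 := by rw [← Real.log_inv]; norm_num
    have e4 : Real.log (1 / 4) = -(2 * Real.log 2) := by
      rw [show (1 / 4 : ℝ) = (1 / 2) ^ 2 by norm_num, Real.log_pow, e2]; push_cast; ring
    rw [e2, e4]
    nlinarith [mul_nonneg hl2.le (mul_nonneg (sub_nonneg.2 ha) (sub_nonneg.2 hb))]

/-- The number of members of the pair containing `i`. -/
def pairCount {ι : Type*} [DecidableEq ι] (x : Finset ι × Finset ι) (i : ι) : ℕ :=
  (if i ∈ x.1 then 1 else 0) + (if i ∈ x.2 then 1 else 0)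

/-- The pair counts restricted to the coordinates in `I`. -/
def pairKey {ι : Type*} [DecidableEq ι] (I : Finset ι) (x : Finset ι × Finset ι) : ι → ℕ :=
  fun i => if i ∈ I then pairCount x i else 0

lemma pairCount_lt {ι : Type*} [DecidableEq ι] (x : Finset ι × Finset ι) (i : ι) :
    pairCount x i < 3 := by
  unfold pairCount; split_ifs <;> norm_num

lemma image_pairKey_subset {ι : Type*} [Fintype ι] [DecidableEq ι]
    (s : Finset (Finset ι × Finset ι)) (I : Finset ι) :
    s.image (pairKey I) ⊆ Fintype.piFinset fun i => if i ∈ I then range 3 else {0} := by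
  intro f hf
  obtain ⟨x, _, rfl⟩ := mem_image.1 hf
  rw [Fintype.mem_piFinset]
  intro i
  by_cases hi : i ∈ I
  · simp [pairKey, hi, pairCount_lt]
  · simp [pairKey, hi]

/-- The number of members of `A` containing `i`. -/
def degreeAt {ι : Type*} [DecidableEq ι] (A : Finset (Finset ι)) (i : ι) : ℕ :=
  (A.filter fun a => i ∈ a).card

lemma sum_pairCount_comp {ι : Type*} [DecidableEq ι] (A : Finset (Finset ι)) (i : ι)
    (f : ℕ → ℝ) :
    ∑ x ∈ A ×ˢ A, f (pairCount x i) = (degreeAt A i : ℝ) ^ 2 * f 2 +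
      2 * degreeAt A i * (A.card - degreeAt A i) * f 1 + (A.card - degreeAt A i) ^ 2 * f 0 := by
  have hc : ((A.filter fun a => i ∉ a).card : ℝ) = A.card - degreeAt A i := by
    have := card_filter_add_card_filter_not (s := A) (fun a => i ∈ a)
    rw [degreeAt, ← this]; push_cast; ring
  have h1 : ∀ (g : ℕ → ℝ), ∑ b ∈ A, g (if i ∈ b then 1 else 0) =
      degreeAt A i * g 1 + (A.card - degreeAt A i) * g 0 := by
    intro g
    rw [← hc, ← sum_filter_add_sum_filter_not A (fun a => i ∈ a)]
    congr 1
    · rw [sum_congr rfl fun b hb => by rw [if_pos (mem_filter.1 hb).2], sum_const, nsmul_eq_mul,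
        degreeAt]
    · rw [sum_congr rfl fun b hb => by rw [if_neg (mem_filter.1 hb).2], sum_const, nsmul_eq_mul]
  rw [sum_product]
  simp only [pairCount]
  rw [sum_congr rfl fun a _ => h1 fun j => f ((if i ∈ a then 1 else 0) + j)]
  rw [h1 fun j => degreeAt A i * f (j + 1) + (A.card - degreeAt A i) * f (j + 0)]
  norm_num
  ring

lemma degreeAt_le {ι : Type*} [DecidableEq ι] (A : Finset (Finset ι)) (i : ι) :
    degreeAt A i ≤ A.card := card_filter_le _ _

lemma sum_sq_pairCount_le {ι : Type*} [DecidableEq ι] (A : Finset (Finset ι)) (hA : A.Nonempty)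
    (i : ι) : ∑ x ∈ A ×ˢ A, ((pairCount x i : ℝ) - 2 * (degreeAt A i / A.card)) ^ 2 ≤
      (A.card : ℝ) ^ 2 / 2 := by
  rw [sum_pairCount_comp A i fun j => ((j : ℝ) - 2 * (degreeAt A i / A.card)) ^ 2]
  have hM : (0 : ℝ) < A.card := by exact_mod_cast hA.card_pos
  obtain ⟨p, hp⟩ : ∃ p : ℝ, p = degreeAt A i / A.card := ⟨_, rfl⟩
  have hd : (degreeAt A i : ℝ) = p * A.card := by rw [hp]; field_simp
  rw [← hp, hd]
  push_cast
  nlinarith [mul_nonneg (sq_nonneg (A.card : ℝ)) (sq_nonneg (2 * p - 1))]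

/-- Lower bound for the average logarithmic size of the key classes. -/
lemma sum_log_keyClass_ge {ι : Type*} [Fintype ι] [DecidableEq ι] (A : Finset (Finset ι))
    (hA : A.Nonempty) (I : Finset ι) :
    (A.card : ℝ) ^ 2 * (2 * Real.log A.card - 1.52 * Real.log 2 * I.card) ≤
      ∑ x ∈ A ×ˢ A, Real.log (keyClass (A ×ˢ A) (pairKey I) x).card := by
  have hM : (0 : ℝ) < A.card := by exact_mod_cast hA.card_pos
  set M : ℝ := (A.card : ℝ) with hMdef
  have hdeg : ∀ i, 0 ≤ degreeAt A i / M ∧ degreeAt A i / M ≤ 1 := fun i =>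
    ⟨by positivity, (div_le_one hM).2 (by rw [hMdef]; exact_mod_cast degreeAt_le A i)⟩
  choose q hq0 hq1 hqc using fun i => exists_ternary_code _ (hdeg i).1 (hdeg i).2
  set w : (ι → ℕ) → ℝ := fun f => ∏ i ∈ I, q i (f i) with hw
  have hwpos : ∀ f, 0 < w f := fun f => prod_pos fun i _ => hq0 i _
  have hsum : ∑ f ∈ (A ×ˢ A).image (pairKey I), w f ≤ 1 := by
    refine (sum_le_sum_of_subset_of_nonneg (image_pairKey_subset _ I)
      fun f _ _ => (hwpos f).le).trans (le_of_eq ?_)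
    have h1 : ∀ f, w f = ∏ i, if i ∈ I then q i (f i) else 1 := fun f => by
      rw [prod_ite_mem, univ_inter]
    rw [sum_congr rfl fun f _ => h1 f,
      ← Finset.prod_univ_sum (fun i => if i ∈ I then range 3 else {0})
        (fun i j => if i ∈ I then q i j else 1)]
    refine prod_eq_one fun i _ => ?_
    by_cases hi : i ∈ I
    · simp [hi, sum_range_succ, hq1]
    · simp [hi]
  set β : Finset ι × Finset ι → ℝ := fun x => (keyClass (A ×ˢ A) (pairKey I) x).card with hβ
  have hβpos : ∀ x ∈ A ×ˢ A, 0 < β x := fun x hx => by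
    simp only [hβ]; exact_mod_cast keyClass_card_pos hx
  have hg := sum_mul_log_div_le (A ×ˢ A) (fun _ => 1 / M ^ 2) (fun x => w (pairKey I x) / β x)
    (fun _ _ => by positivity) (fun x hx => div_pos (hwpos _) (hβpos x hx))
  rw [sum_div_keyClass (A ×ˢ A) (pairKey I) w, sum_const, card_product, nsmul_eq_mul,
    ← mul_sum] at hg
  have h1 : (((A.card * A.card : ℕ) : ℝ)) * (1 / M ^ 2) = 1 := by
    push_cast; rw [← hMdef]; field_simp
  rw [h1] at hg
  have h2 : ∑ x ∈ A ×ˢ A, Real.log (w (pairKey I x) / β x / (1 / M ^ 2)) ≤ 0 := by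
    have h3 : 1 / M ^ 2 * ∑ x ∈ A ×ˢ A, Real.log (w (pairKey I x) / β x / (1 / M ^ 2)) ≤ 0 :=
      hg.trans (by linarith)
    by_contra h
    exact absurd h3 (not_le.2 (mul_pos (by positivity) (not_le.1 h)))
  have h4 : ∀ x ∈ A ×ˢ A, Real.log (w (pairKey I x) / β x / (1 / M ^ 2)) =
      ∑ i ∈ I, Real.log (q i (pairCount x i)) - Real.log (β x) + 2 * Real.log M := by
    intro x hx
    rw [Real.log_div (div_pos (hwpos _) (hβpos x hx)).ne' (by positivity),
      Real.log_div (hwpos _).ne' (hβpos x hx).ne', one_div, Real.log_inv, Real.log_pow, hw,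
      Real.log_prod (fun i _ => (hq0 i _).ne')]
    have : ∀ i ∈ I, Real.log (q i (pairKey I x i)) = Real.log (q i (pairCount x i)) :=
      fun i hi => by simp [pairKey, hi]
    rw [sum_congr rfl this]
    push_cast
    ring
  rw [sum_congr rfl h4, sum_add_distrib, sum_sub_distrib, sum_const, card_product, nsmul_eq_mul,
    sum_comm] at h2
  have h5 : -(M ^ 2 * (1.52 * Real.log 2 * I.card)) ≤
      ∑ i ∈ I, ∑ x ∈ A ×ˢ A, Real.log (q i (pairCount x i)) := by
    have : ∀ i ∈ I, -(M ^ 2 * (1.52 * Real.log 2)) ≤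
        ∑ x ∈ A ×ˢ A, Real.log (q i (pairCount x i)) := by
      intro i _
      rw [sum_pairCount_comp A i fun j => Real.log (q i j)]
      have h6 := mul_le_mul_of_nonneg_left (hqc i) (sq_nonneg M)
      have hd : (degreeAt A i : ℝ) = (degreeAt A i / M) * M := by field_simp
      rw [← hMdef, hd]
      linarith
    have h7 := sum_le_sum this
    rw [sum_const, nsmul_eq_mul] at h7
    linarith
  push_cast at h2
  rw [← hMdef] at h2
  linarith

/-- Two collections of at most `t` words with the same number of words and the same
coordinate counts agree. -/
def IsSumDistinct {ι : Type*} [DecidableEq ι] (t : ℕ) (A : Finset (Finset ι)) : Prop :=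
  ∀ s s' : Multiset (Finset ι), (∀ a ∈ s, a ∈ A) → (∀ a ∈ s', a ∈ A) →
    s.card = s'.card → s.card ≤ t →
    (∀ i, s.countP (fun a => i ∈ a) = s'.countP (fun a => i ∈ a)) → s = s'

/-- The two pairs have no member in common. -/
abbrev PairDisjoint {α : Type*} (x y : α × α) : Prop :=
  x.1 ≠ y.1 ∧ x.1 ≠ y.2 ∧ x.2 ≠ y.1 ∧ x.2 ≠ y.2

/-- The difference of the pair counts. -/
def pairDiff {ι : Type*} [DecidableEq ι] (o : (Finset ι × Finset ι) × (Finset ι × Finset ι))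
    (i : ι) : ℤ := pairCount o.1 i - pairCount o.2 i

/-- A distribution on `{-2, …, 2}`. -/
noncomputable def diffWeight (d : ℤ) : ℝ := 8 / 17 * (1 / 2) ^ (d.natAbs ^ 2)

lemma diffWeight_pos (d : ℤ) : 0 < diffWeight d := by unfold diffWeight; positivity

lemma sum_diffWeight : ∑ d ∈ Icc (-2 : ℤ) 2, diffWeight d = 1 := by
  have : Icc (-2 : ℤ) 2 = {-2, -1, 0, 1, 2} := by decide
  rw [this]
  simp [diffWeight]
  norm_num

lemma log_diffWeight (d : ℤ) :
    Real.log (diffWeight d) = -Real.log (17 / 8) - (d : ℝ) ^ 2 * Real.log 2 := by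
  have h1 : Real.log (8 / 17) = -Real.log (17 / 8) := by rw [← Real.log_inv]; norm_num
  have h2 : Real.log (1 / 2) = -Real.log 2 := by rw [← Real.log_inv]; norm_num
  have h3 : ((d.natAbs : ℝ)) ^ 2 = (d : ℝ) ^ 2 := by
    rw [← Int.cast_natCast, Int.natCast_natAbs]; simp
  rw [diffWeight, Real.log_mul (by norm_num) (by positivity), Real.log_pow, h1, h2]
  push_cast
  rw [h3]
  ring

lemma Multiset.eq_of_add_eq_add_of_disjoint {α : Type*} [DecidableEq α] {s t s' t' : Multiset α}
    (h : s + t = s' + t') (h1 : ∀ a ∈ s, a ∉ t') (h2 : ∀ a ∈ s', a ∉ t) : s = s' := by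
  ext w
  have hw := congrArg (Multiset.count w) h
  rw [Multiset.count_add, Multiset.count_add] at hw
  by_cases hs : w ∈ s
  · have h3 := Multiset.count_eq_zero.2 (h1 w hs)
    by_cases ht : w ∈ t
    · have h4 : w ∉ s' := fun h => h2 w h ht
      have h5 := Multiset.count_eq_zero.2 h4
      have := Multiset.count_pos.2 hs
      omega
    · have := Multiset.count_eq_zero.2 ht
      omega
  · have h3 := Multiset.count_eq_zero.2 hs
    by_cases hs' : w ∈ s'
    · have := Multiset.count_eq_zero.2 (h2 w hs')
      have := Multiset.count_pos.2 hs'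
      omega
    · rw [h3, Multiset.count_eq_zero.2 hs']

lemma Multiset.pair_eq_pair {α : Type*} {a b c d : α} (h : ({a, b} : Multiset α) = {c, d}) :
    (a = c ∧ b = d) ∨ (a = d ∧ b = c) := by
  have hc : a ∈ ({c, d} : Multiset α) := h ▸ (by simp)
  rcases (by simpa using hc : a = c ∨ a = d) with rfl | rfl
  · left
    have : ({b} : Multiset α) = {d} := (Multiset.cons_inj_right a).1 h
    exact ⟨rfl, Multiset.singleton_inj.1 this⟩
  · right
    rw [Multiset.pair_comm c a] at h
    have : ({b} : Multiset α) = {c} := (Multiset.cons_inj_right a).1 h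
    exact ⟨rfl, Multiset.singleton_inj.1 this⟩

lemma pairDiff_determines {ι : Type*} [DecidableEq ι] {A : Finset (Finset ι)}
    (hA : IsSumDistinct 4 A) {x y x' y' : Finset ι × Finset ι} (hx : x ∈ A ×ˢ A)
    (hy : y ∈ A ×ˢ A) (hx' : x' ∈ A ×ˢ A) (hy' : y' ∈ A ×ˢ A) (h : PairDisjoint x y)
    (h' : PairDisjoint x' y') (hd : pairDiff (x', y') = pairDiff (x, y)) :
    (x', y') ∈ ({x, x.swap} : Finset _) ×ˢ ({y, y.swap} : Finset _) := by
  obtain ⟨a, b⟩ := x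
  obtain ⟨c, d⟩ := y
  obtain ⟨a', b'⟩ := x'
  obtain ⟨c', d'⟩ := y'
  rw [mem_product] at hx hy hx' hy'
  have hm : ({a', b'} : Multiset (Finset ι)) + {c, d} = {a, b} + {c', d'} := by
    refine hA _ _ ?_ ?_ rfl (le_of_eq rfl) ?_
    · intro w hw
      simp only [Multiset.mem_add, Multiset.insert_eq_cons, Multiset.mem_cons,
        Multiset.mem_singleton] at hw
      rcases hw with (rfl | rfl) | (rfl | rfl)
      exacts [hx'.1, hx'.2, hy.1, hy.2]
    · intro w hw
      simp only [Multiset.mem_add, Multiset.insert_eq_cons, Multiset.mem_cons,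
        Multiset.mem_singleton] at hw
      rcases hw with (rfl | rfl) | (rfl | rfl)
      exacts [hx.1, hx.2, hy'.1, hy'.2]
    · intro i
      have hc : ∀ u v : Finset ι, ({u, v} : Multiset (Finset ι)).countP (fun a => i ∈ a) =
          pairCount (u, v) i := by
        intro u v
        simp only [pairCount, Multiset.insert_eq_cons, Multiset.countP_cons, add_comm]
        simp [← Multiset.cons_zero, Multiset.countP_cons]
      rw [Multiset.countP_add, Multiset.countP_add, hc, hc, hc, hc]
      have := congrFun hd i
      simp only [pairDiff] at this
      omega
  have h1 : ({a', b'} : Multiset (Finset ι)) = {a, b} := by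
    refine Multiset.eq_of_add_eq_add_of_disjoint hm ?_ ?_
    · intro w hw hw'
      simp only [Multiset.insert_eq_cons, Multiset.mem_cons, Multiset.mem_singleton] at hw hw'
      rcases hw with e | e <;> rcases hw' with e' | e'
      exacts [h'.1 (e.symm.trans e'), h'.2.1 (e.symm.trans e'), h'.2.2.1 (e.symm.trans e'),
        h'.2.2.2 (e.symm.trans e')]
    · intro w hw hw'
      simp only [Multiset.insert_eq_cons, Multiset.mem_cons, Multiset.mem_singleton] at hw hw'
      rcases hw with e | e <;> rcases hw' with e' | e'
      exacts [h.1 (e.symm.trans e'), h.2.1 (e.symm.trans e'), h.2.2.1 (e.symm.trans e'),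
        h.2.2.2 (e.symm.trans e')]
  have h2 : ({c, d} : Multiset (Finset ι)) = {c', d'} := by
    rw [h1] at hm
    exact add_left_cancel hm
  simp only [mem_product, mem_insert, mem_singleton, Prod.swap_prod_mk, Prod.mk.injEq]
  refine ⟨Multiset.pair_eq_pair h1, ?_⟩
  rcases Multiset.pair_eq_pair h2 with ⟨rfl, rfl⟩ | ⟨rfl, rfl⟩ <;> simp

/-- Disjoint pairs of pairs with the same key. -/
def separatedPairs {ι : Type*} [Fintype ι] [DecidableEq ι] (A : Finset (Finset ι))
    (I : Finset ι) : Finset ((Finset ι × Finset ι) × (Finset ι × Finset ι)) :=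
  ((A ×ˢ A) ×ˢ (A ×ˢ A)).filter fun o => pairKey I o.2 = pairKey I o.1 ∧ PairDisjoint o.1 o.2

lemma sum_separatedPairs {ι : Type*} [Fintype ι] [DecidableEq ι] (A : Finset (Finset ι))
    (I : Finset ι) (F : Finset ι × Finset ι → Finset ι × Finset ι → ℝ) :
    ∑ o ∈ separatedPairs A I, F o.1 o.2 = ∑ x ∈ A ×ˢ A,
      ∑ y ∈ (keyClass (A ×ˢ A) (pairKey I) x).filter (PairDisjoint x), F x y := by
  rw [separatedPairs, sum_filter, sum_product]
  refine sum_congr rfl fun x _ => ?_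
  rw [keyClass, filter_filter, sum_filter]

lemma sum_prod_diffWeight_le {ι : Type*} [Fintype ι] [DecidableEq ι] {A : Finset (Finset ι)}
    (hA : IsSumDistinct 4 A) (I : Finset ι) :
    ∑ o ∈ separatedPairs A I, ∏ i ∈ Iᶜ, diffWeight (pairDiff o i) ≤ 4 := by
  set w : (ι → ℤ) → ℝ := fun f => ∏ i ∈ Iᶜ, diffWeight (f i) with hw
  have hwpos : ∀ f, 0 ≤ w f := fun f => prod_nonneg fun i _ => (diffWeight_pos _).le
  have h1 := Finset.sum_comp (s := separatedPairs A I) w pairDiff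
  change ∑ o ∈ separatedPairs A I, w (pairDiff o) ≤ 4
  rw [h1]
  have hcard : ∀ f ∈ (separatedPairs A I).image pairDiff,
      ((separatedPairs A I).filter fun o => pairDiff o = f).card ≤ 4 := by
    intro f hf
    obtain ⟨⟨x, y⟩, ho, rfl⟩ := mem_image.1 hf
    have hsub : (separatedPairs A I).filter (fun o => pairDiff o = pairDiff (x, y)) ⊆
        ({x, x.swap} : Finset _) ×ˢ ({y, y.swap} : Finset _) := by
      rintro ⟨x', y'⟩ ho'
      obtain ⟨ho', hd⟩ := mem_filter.1 ho'
      obtain ⟨hm, -, hdis⟩ := mem_filter.1 ho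
      obtain ⟨hm', -, hdis'⟩ := mem_filter.1 ho'
      rw [mem_product] at hm hm'
      exact pairDiff_determines hA hm.1 hm.2 hm'.1 hm'.2 hdis hdis' hd
    refine (card_le_card hsub).trans ?_
    rw [card_product]
    exact Nat.mul_le_mul card_le_two card_le_two
  have hsum : ∑ f ∈ (separatedPairs A I).image pairDiff, w f ≤ 1 := by
    have hsub : (separatedPairs A I).image pairDiff ⊆
        Fintype.piFinset fun i => if i ∈ Iᶜ then Icc (-2 : ℤ) 2 else {0} := by
      intro f hf
      obtain ⟨o, ho, rfl⟩ := mem_image.1 hf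
      rw [Fintype.mem_piFinset]
      intro i
      have h1 := pairCount_lt o.1 i
      have h2 := pairCount_lt o.2 i
      by_cases hi : i ∈ I
      · have := congrFun (mem_filter.1 ho).2.1 i
        simp only [pairKey, hi, if_true] at this
        simp [pairDiff, hi, this]
      · simp only [pairDiff, mem_compl, hi, not_false_eq_true, if_true, mem_Icc]
        omega
    refine (sum_le_sum_of_subset_of_nonneg hsub fun f _ _ => hwpos f).trans (le_of_eq ?_)
    have h1 : ∀ f, w f = ∏ i, if i ∈ Iᶜ then diffWeight (f i) else 1 := fun f => by
      rw [prod_ite_mem, univ_inter]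
    rw [sum_congr rfl fun f _ => h1 f,
      ← Finset.prod_univ_sum (fun i => if i ∈ Iᶜ then Icc (-2 : ℤ) 2 else {0})
        (fun i j => if i ∈ Iᶜ then diffWeight j else 1)]
    refine prod_eq_one fun i _ => ?_
    by_cases hi : i ∈ Iᶜ
    · simp only [hi, if_true, sum_diffWeight]
    · simp only [hi, if_false, sum_const, card_singleton, one_smul]
  calc _ ≤ ∑ f ∈ (separatedPairs A I).image pairDiff, 4 * w f := by
        refine sum_le_sum fun f hf => ?_
        rw [nsmul_eq_mul]
        refine mul_le_mul_of_nonneg_right ?_ (hwpos f)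
        exact_mod_cast hcard f hf
    _ ≤ 4 := by rw [← mul_sum]; linarith

/-- The entropy bound for codes with distinct sums of four words. -/
lemma log_card_le_of_sum_bad_le {ι : Type*} [Fintype ι] [DecidableEq ι] {A : Finset (Finset ι)}
    (hne : A.Nonempty) (hA : IsSumDistinct 4 A) (I : Finset ι) {δ : ℝ}
    (hδ : ∑ x ∈ A ×ˢ A,
      (((keyClass (A ×ˢ A) (pairKey I) x).filter fun y => ¬PairDisjoint x y).card : ℝ) /
        (keyClass (A ×ˢ A) (pairKey I) x).card ≤ δ * (A.card : ℝ) ^ 2) :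
    4 * Real.log A.card * (1 - δ) ≤
      1 + Real.log 4 + 1.52 * Real.log 2 * I.card + Iᶜ.card * Real.log (17 / 4) := by
  have hM : (0 : ℝ) < A.card := by exact_mod_cast hne.card_pos
  have hM1 : (1 : ℝ) ≤ A.card := by exact_mod_cast hne.card_pos
  have hent := sum_log_keyClass_ge A hne I
  have hlog2 : 0 ≤ Real.log 2 := Real.log_nonneg (by norm_num)
  have hlog4 : 0 ≤ Real.log 4 := Real.log_nonneg (by norm_num)
  have hlog17 : 0 ≤ Real.log (17 / 8) := Real.log_nonneg (by norm_num)
  have hlogM : 0 ≤ Real.log A.card := Real.log_nonneg hM1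
  set M : ℝ := (A.card : ℝ) with hMdef
  set β : Finset ι × Finset ι → ℝ := fun x => (keyClass (A ×ˢ A) (pairKey I) x).card with hβ
  have hβpos : ∀ x ∈ A ×ˢ A, 0 < β x := fun x hx => by
    simp only [hβ]; exact_mod_cast keyClass_card_pos hx
  have hβle : ∀ x, β x ≤ M ^ 2 := fun x => by
    simp only [hβ, hMdef]
    have : (keyClass (A ×ˢ A) (pairKey I) x).card ≤ A.card ^ 2 := by
      rw [sq, ← card_product]; exact card_filter_le _ _
    exact_mod_cast this
  have hmem : ∀ o ∈ separatedPairs A I, o.1 ∈ A ×ˢ A := fun o ho =>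
    (mem_product.1 (mem_filter.1 ho).1).1
  have hle : ∀ F : Finset ι × Finset ι → Finset ι × Finset ι → ℝ, (∀ x y, 0 ≤ F x y) →
      ∑ o ∈ separatedPairs A I, 1 / (M ^ 2 * β o.1) * F o.1 o.2 ≤
        (∑ x ∈ A ×ˢ A, (∑ y ∈ keyClass (A ×ˢ A) (pairKey I) x, F x y) / β x) / M ^ 2 := by
    intro F hF
    rw [sum_separatedPairs A I fun x y => 1 / (M ^ 2 * β x) * F x y, sum_div]
    refine sum_le_sum fun x hx => ?_
    have := hβpos x hx
    rw [← mul_sum, one_div_mul_eq_div, div_div, mul_comm (β x)]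
    gcongr
    · exact fun _ _ _ => hF _ _
    · exact filter_subset _ _
  have hT : ∑ o ∈ separatedPairs A I, 1 / (M ^ 2 * β o.1) ≤ 1 := by
    have h1 := hle (fun _ _ => 1) fun _ _ => zero_le_one
    simp only [mul_one, sum_const, nsmul_eq_mul] at h1
    refine h1.trans ?_
    rw [sum_congr rfl fun x hx => div_self (hβpos x hx).ne', sum_const, card_product, nsmul_eq_mul]
    push_cast
    rw [← hMdef]
    apply le_of_eq
    field_simp
  have hT0 : 0 ≤ ∑ o ∈ separatedPairs A I, 1 / (M ^ 2 * β o.1) :=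
    sum_nonneg fun o _ => by positivity
  have hD : ∀ i, ∑ o ∈ separatedPairs A I, 1 / (M ^ 2 * β o.1) * (pairDiff o i : ℝ) ^ 2 ≤ 1 := by
    intro i
    set h : Finset ι × Finset ι → ℝ := fun x => (pairCount x i : ℝ) - 2 * (degreeAt A i / M)
      with hh
    have h1 := hle (fun x y => (h x - h y) ^ 2) fun _ _ => sq_nonneg _
    have h2 := sum_sq_sub_keyClass_le (A ×ˢ A) (pairKey I) h
    have h3 := sum_sq_pairCount_le A hne i
    have h4 : ∀ o : (Finset ι × Finset ι) × (Finset ι × Finset ι),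
        (pairDiff o i : ℝ) ^ 2 = (h o.1 - h o.2) ^ 2 := by
      intro o
      simp only [pairDiff, hh]
      push_cast
      ring
    rw [sum_congr rfl fun o _ => by rw [h4 o]]
    refine h1.trans ((div_le_one (by positivity)).2 ?_)
    linarith
  have hq := sum_prod_diffWeight_le hA I
  have hw : ∀ o : (Finset ι × Finset ι) × (Finset ι × Finset ι),
      0 < ∏ i ∈ Iᶜ, diffWeight (pairDiff o i) := fun o => prod_pos fun i _ => diffWeight_pos _
  have hg := sum_mul_log_div_le (separatedPairs A I) (fun o => 1 / (M ^ 2 * β o.1))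
    (fun o => (∏ i ∈ Iᶜ, diffWeight (pairDiff o i)) / 4)
    (fun o ho => by have := hβpos _ (hmem o ho); positivity)
    (fun o _ => div_pos (hw o) (by norm_num))
  have hterm : ∀ o ∈ separatedPairs A I, 1 / (M ^ 2 * β o.1) *
      Real.log ((∏ i ∈ Iᶜ, diffWeight (pairDiff o i)) / 4 / (1 / (M ^ 2 * β o.1))) =
      1 / (M ^ 2 * β o.1) * (2 * Real.log M + Real.log (β o.1))
      - 1 / (M ^ 2 * β o.1) * (Real.log 4 + Iᶜ.card * Real.log (17 / 8))
      - ∑ i ∈ Iᶜ, Real.log 2 * (1 / (M ^ 2 * β o.1) * (pairDiff o i : ℝ) ^ 2) := by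
    intro o ho
    have hb := hβpos _ (hmem o ho)
    rw [Real.log_div (div_pos (hw o) (by norm_num)).ne' (by positivity),
      Real.log_div (hw o).ne' (by norm_num), Real.log_prod fun i _ => (diffWeight_pos _).ne',
      one_div, Real.log_inv, Real.log_mul (by positivity) hb.ne', Real.log_pow]
    simp only [log_diffWeight, sum_sub_distrib, sum_const, nsmul_eq_mul, ← mul_sum, ← sum_mul]
    push_cast
    ring
  rw [sum_congr rfl hterm, sum_sub_distrib, sum_sub_distrib, ← sum_mul, sum_comm, ← sum_div] at hg
  have hDsum : ∑ i ∈ Iᶜ, ∑ o ∈ separatedPairs A I,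
      Real.log 2 * (1 / (M ^ 2 * β o.1) * (pairDiff o i : ℝ) ^ 2) ≤ Iᶜ.card * Real.log 2 := by
    rw [← nsmul_eq_mul, ← sum_const]
    refine sum_le_sum fun i _ => ?_
    rw [← mul_sum]
    exact mul_le_of_le_one_right hlog2 (hD i)
  have hTmul : (∑ o ∈ separatedPairs A I, 1 / (M ^ 2 * β o.1)) *
      (Real.log 4 + Iᶜ.card * Real.log (17 / 8)) ≤ Real.log 4 + Iᶜ.card * Real.log (17 / 8) :=
    mul_le_of_le_one_left (by positivity) hT
  have hmain : 4 * Real.log M * (1 - δ) - 1.52 * Real.log 2 * I.card ≤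
      ∑ o ∈ separatedPairs A I, 1 / (M ^ 2 * β o.1) * (2 * Real.log M + Real.log (β o.1)) := by
    rw [sum_separatedPairs A I fun x _ => 1 / (M ^ 2 * β x) * (2 * Real.log M + Real.log (β x))]
    have h1 : ∀ x ∈ A ×ˢ A, (1 / M ^ 2) * (2 * Real.log M + Real.log (β x)
        - 4 * Real.log M * ((((keyClass (A ×ˢ A) (pairKey I) x).filter
          fun y => ¬PairDisjoint x y).card : ℝ) / β x)) ≤
        ∑ y ∈ (keyClass (A ×ˢ A) (pairKey I) x).filter (PairDisjoint x),
          1 / (M ^ 2 * β x) * (2 * Real.log M + Real.log (β x)) := by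
      intro x hx
      have hb := hβpos x hx
      have hc : (((keyClass (A ×ˢ A) (pairKey I) x).filter (PairDisjoint x)).card : ℝ) =
          β x - ((keyClass (A ×ˢ A) (pairKey I) x).filter fun y => ¬PairDisjoint x y).card := by
        have := card_filter_add_card_filter_not (s := keyClass (A ×ˢ A) (pairKey I) x)
          (PairDisjoint x)
        simp only [hβ]
        rw [← this]
        push_cast
        ring
      rw [sum_const, nsmul_eq_mul, hc]
      have hlogβ : Real.log (β x) ≤ 2 * Real.log M := by
        have := Real.log_le_log hb (hβle x)
        rwa [Real.log_pow, Nat.cast_ofNat] at this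
      have hu : (0 : ℝ) ≤ ((keyClass (A ×ˢ A) (pairKey I) x).filter
        fun y => ¬PairDisjoint x y).card := Nat.cast_nonneg _
      generalize (((keyClass (A ×ˢ A) (pairKey I) x).filter
        fun y => ¬PairDisjoint x y).card : ℝ) = u at hu ⊢
      have hnn : 0 ≤ 1 / M ^ 2 * (u / β x * (2 * Real.log M - Real.log (β x))) :=
        mul_nonneg (by positivity) (mul_nonneg (by positivity) (by linarith))
      have e : (β x - u) * (1 / (M ^ 2 * β x) * (2 * Real.log M + Real.log (β x))) =
          1 / M ^ 2 * ((1 - u / β x) * (2 * Real.log M + Real.log (β x))) := by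
        field_simp
      rw [e]
      linarith
    have h2 := sum_le_sum h1
    rw [← mul_sum, sum_sub_distrib, sum_add_distrib, sum_const, card_product, nsmul_eq_mul,
      ← mul_sum] at h2
    refine le_trans ?_ h2
    push_cast
    rw [← hMdef, one_div_mul_eq_div, le_div_iff₀ (by positivity)]
    have h3 := mul_le_mul_of_nonneg_left hδ (by positivity : 0 ≤ 4 * Real.log M)
    linarith
  have h178 : Real.log (17 / 4) = Real.log (17 / 8) + Real.log 2 := by
    rw [← Real.log_mul (by norm_num) (by norm_num)]; norm_num
  rw [h178]
  linarith

lemma mul_card_keyClass_le {ι : Type*} [Fintype ι] [DecidableEq ι] {A : Finset (Finset ι)}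
    (I a b : Finset ι) :
    (keyClass A (· ∩ I) a).card * (keyClass A (· ∩ I) b).card ≤
      (keyClass (A ×ˢ A) (pairKey I) (a, b)).card := by
  rw [← card_product]
  refine card_le_card ?_
  rintro ⟨c, d⟩ h
  simp only [keyClass, mem_product, mem_filter] at h ⊢
  refine ⟨⟨h.1.1, h.2.1⟩, ?_⟩
  ext i
  have h1 := congrArg (i ∈ ·) h.1.2
  have h2 := congrArg (i ∈ ·) h.2.2
  by_cases hi : i ∈ I
  · simp only [mem_inter, hi, and_true, eq_iff_iff] at h1 h2
    simp only [pairKey, pairCount, hi, h1, h2]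
  · simp [pairKey, hi]

lemma inter_eq_inter_of_pairCount {ι : Type*} [DecidableEq ι] {I a b c d : Finset ι}
    (h : pairKey I (c, d) = pairKey I (a, b)) (hc : c = a) : d ∩ I = b ∩ I := by
  subst hc
  ext i
  have h1 := congrFun h i
  by_cases hi : i ∈ I
  · simp only [pairKey, pairCount, hi, if_true, add_right_inj] at h1
    by_cases hd : i ∈ d <;> by_cases hb : i ∈ b <;> simp_all
  · simp [hi]

lemma pairKey_swap {ι : Type*} [DecidableEq ι] (I a b : Finset ι) :
    pairKey I (a, b) = pairKey I (b, a) := by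
  ext i
  simp only [pairKey, pairCount, add_comm]

/-- Few pairs with the same key as `(a, b)` share a word with it. -/
lemma card_not_pairDisjoint_le {ι : Type*} [Fintype ι] [DecidableEq ι]
    {A : Finset (Finset ι)}
    (I a b : Finset ι) :
    ((keyClass (A ×ˢ A) (pairKey I) (a, b)).filter fun y => ¬PairDisjoint (a, b) y).card ≤
      2 * (keyClass A (· ∩ I) a).card + 2 * (keyClass A (· ∩ I) b).card := by
  set P := keyClass A (· ∩ I) a with hP
  set Q := keyClass A (· ∩ I) b with hQ
  have hsub : (keyClass (A ×ˢ A) (pairKey I) (a, b)).filter (fun y => ¬PairDisjoint (a, b) y) ⊆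
      (({a} ×ˢ Q) ∪ (Q ×ˢ {a})) ∪ (({b} ×ˢ P) ∪ (P ×ˢ {b})) := by
    rintro ⟨c, d⟩ h
    simp only [keyClass, mem_filter, mem_product] at h
    obtain ⟨⟨⟨hc, hd⟩, hk⟩, hdis⟩ := h
    simp only [mem_union, mem_product, mem_singleton, hP, hQ, keyClass, mem_filter]
    by_cases h1 : c = a
    · exact Or.inl (Or.inl ⟨h1, hd, inter_eq_inter_of_pairCount hk h1⟩)
    by_cases h2 : d = a
    · refine Or.inl (Or.inr ⟨⟨hc, ?_⟩, h2⟩)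
      exact inter_eq_inter_of_pairCount ((pairKey_swap I d c).trans hk) h2
    by_cases h3 : c = b
    · refine Or.inr (Or.inl ⟨h3, hd, ?_⟩)
      exact inter_eq_inter_of_pairCount (hk.trans (pairKey_swap I a b)) h3
    by_cases h4 : d = b
    · refine Or.inr (Or.inr ⟨⟨hc, ?_⟩, h4⟩)
      exact inter_eq_inter_of_pairCount
        (((pairKey_swap I d c).trans hk).trans (pairKey_swap I a b)) h4
    · exact absurd ⟨Ne.symm h1, Ne.symm h2, Ne.symm h3, Ne.symm h4⟩ hdis
  refine (card_le_card hsub).trans ?_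
  have h1 := card_union_le (({a} ×ˢ Q) ∪ (Q ×ˢ {a})) (({b} ×ˢ P) ∪ (P ×ˢ {b}))
  have h2 := card_union_le ({a} ×ˢ Q) (Q ×ˢ {a})
  have h3 := card_union_le ({b} ×ˢ P) (P ×ˢ {b})
  simp only [card_product, card_singleton] at h2 h3
  omega

lemma sum_not_pairDisjoint_le_of_le {ι : Type*} [Fintype ι] [DecidableEq ι]
    {A : Finset (Finset ι)} (I : Finset ι) {K : ℝ} (hK : 0 < K)
    (hA : ∀ a ∈ A, K ≤ (keyClass A (· ∩ I) a).card) :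
    ∑ x ∈ A ×ˢ A,
      (((keyClass (A ×ˢ A) (pairKey I) x).filter fun y => ¬PairDisjoint x y).card : ℝ) /
        (keyClass (A ×ˢ A) (pairKey I) x).card ≤ 4 / K * (A.card : ℝ) ^ 2 := by
  have h : ∀ x ∈ A ×ˢ A,
      (((keyClass (A ×ˢ A) (pairKey I) x).filter fun y => ¬PairDisjoint x y).card : ℝ) /
        (keyClass (A ×ˢ A) (pairKey I) x).card ≤ 4 / K := by
    rintro ⟨a, b⟩ hx
    have hpos : (0 : ℝ) < (keyClass (A ×ˢ A) (pairKey I) (a, b)).card := by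
      exact_mod_cast keyClass_card_pos hx
    have h1 : (((keyClass A (· ∩ I) a).card * (keyClass A (· ∩ I) b).card : ℕ) : ℝ) ≤
      (keyClass (A ×ˢ A) (pairKey I) (a, b)).card := by exact_mod_cast mul_card_keyClass_le I a b
    have h2 : (((keyClass (A ×ˢ A) (pairKey I) (a, b)).filter
        fun y => ¬PairDisjoint (a, b) y).card : ℝ) ≤
        ((2 * (keyClass A (· ∩ I) a).card + 2 * (keyClass A (· ∩ I) b).card : ℕ) : ℝ) := by
      exact_mod_cast card_not_pairDisjoint_le I a b
    rw [mem_product] at hx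
    have ha := hA a hx.1
    have hb := hA b hx.2
    push_cast at h1 h2
    rw [div_le_div_iff₀ hpos hK]
    nlinarith
  refine (sum_le_sum h).trans (le_of_eq ?_)
  rw [sum_const, card_product, nsmul_eq_mul]
  push_cast
  ring

lemma card_image_pairKey_le {ι : Type*} [Fintype ι] [DecidableEq ι] (A : Finset (Finset ι))
    (I : Finset ι) : ((A ×ˢ A).image (pairKey I)).card ≤ 3 ^ I.card := by
  refine (card_le_card (image_pairKey_subset _ I)).trans (le_of_eq ?_)
  rw [Fintype.card_piFinset, ← prod_const, ← prod_subset (subset_univ I)]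
  · exact prod_congr rfl fun i hi => by simp [hi]
  · intro i _ hi
    simp [hi]

lemma sum_not_pairDisjoint_le_of_ge {ι : Type*} [Fintype ι] [DecidableEq ι]
    {A : Finset (Finset ι)} (I : Finset ι) {K : ℝ} (hK : 0 ≤ K)
    (hA : ∀ a ∈ A, (keyClass A (· ∩ I) a).card ≤ K) :
    ∑ x ∈ A ×ˢ A,
      (((keyClass (A ×ˢ A) (pairKey I) x).filter fun y => ¬PairDisjoint x y).card : ℝ) /
        (keyClass (A ×ˢ A) (pairKey I) x).card ≤ 4 * K * 3 ^ I.card := by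
  have h : ∀ x ∈ A ×ˢ A,
      (((keyClass (A ×ˢ A) (pairKey I) x).filter fun y => ¬PairDisjoint x y).card : ℝ) /
        (keyClass (A ×ˢ A) (pairKey I) x).card ≤
      4 * K / (keyClass (A ×ˢ A) (pairKey I) x).card := by
    rintro ⟨a, b⟩ hx
    gcongr
    have h2 : (((keyClass (A ×ˢ A) (pairKey I) (a, b)).filter
        fun y => ¬PairDisjoint (a, b) y).card : ℝ) ≤
        ((2 * (keyClass A (· ∩ I) a).card + 2 * (keyClass A (· ∩ I) b).card : ℕ) : ℝ) := by
      exact_mod_cast card_not_pairDisjoint_le I a b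
    rw [mem_product] at hx
    have ha := hA a hx.1
    have hb := hA b hx.2
    push_cast at h2
    linarith
  refine (sum_le_sum h).trans ?_
  rw [sum_div_keyClass (A ×ˢ A) (pairKey I) fun _ => 4 * K, sum_const, nsmul_eq_mul, mul_comm]
  have : (((A ×ˢ A).image (pairKey I)).card : ℝ) ≤ 3 ^ I.card := by
    exact_mod_cast card_image_pairKey_le A I
  gcongr

lemma IsSumDistinct.mono {ι : Type*} [DecidableEq ι] {t : ℕ} {A B : Finset (Finset ι)}
    (hA : IsSumDistinct t A) (h : B ⊆ A) : IsSumDistinct t B :=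
  fun s s' hs hs' => hA s s' (fun a ha => h (hs a ha)) fun a ha => h (hs' a ha)

lemma card_le_of_sum_bad_le {ι : Type*} [Fintype ι] [DecidableEq ι] {A : Finset (Finset ι)}
    (hA : IsSumDistinct 4 A) (N : ℕ) (hι : Fintype.card ι = 1250 * N) {I : Finset ι}
    (hI : I.card = 700 * N)
    (hbad : ∑ x ∈ A ×ˢ A,
      (((keyClass (A ×ˢ A) (pairKey I) x).filter fun y => ¬PairDisjoint x y).card : ℝ) /
        (keyClass (A ×ˢ A) (pairKey I) x).card ≤ 1 / 1000 * (A.card : ℝ) ^ 2) :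
    (A.card : ℝ) ≤ 2 * 2 ^ (556 * N) := by
  rcases A.eq_empty_or_nonempty with rfl | hne
  · simp
  have h := log_card_le_of_sum_bad_le hne hA I hbad
  have hIc : Iᶜ.card = 550 * N := by rw [card_compl, hι, hI]; omega
  rw [hIc, hI] at h
  have hpos : (0 : ℝ) < A.card := by exact_mod_cast hne.card_pos
  have h17 : Real.log (17 / 4) ≤ 2.1 * Real.log 2 := by
    have h : Real.log ((17 / 4 : ℝ) ^ 10) ≤ Real.log (2 ^ 21) :=
      Real.log_le_log (by norm_num) (by norm_num)
    rw [Real.log_pow, Real.log_pow] at h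
    push_cast at h
    linarith
  have h4 : Real.log 4 = 2 * Real.log 2 := by
    rw [show (4 : ℝ) = 2 ^ 2 by norm_num, Real.log_pow]; push_cast; ring
  rw [← Real.log_le_log_iff hpos (by positivity), Real.log_mul (by norm_num) (by positivity),
    Real.log_pow]
  have h2 := Real.log_two_gt_d9
  have hN : (0 : ℝ) ≤ N := Nat.cast_nonneg N
  have h5 := mul_le_mul_of_nonneg_left h17 hN
  have h6 : 0 ≤ N * Real.log 2 := by positivity
  push_cast at h ⊢
  linarith

set_option exponentiation.threshold 300 in
/-- A family whose sums of four members are distinct is small. -/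
lemma sumDistinct_four_card_le {ι : Type*} [Fintype ι] [DecidableEq ι] {A : Finset (Finset ι)}
    (hA : IsSumDistinct 4 A) (N : ℕ) (hι : Fintype.card ι = 1250 * N) :
    (A.card : ℝ) ≤ 4002 * 2 ^ (556 * N) := by
  obtain ⟨I, -, hI⟩ := exists_subset_card_eq (s := (univ : Finset ι)) (n := 700 * N)
    (by rw [card_univ, hι]; omega)
  set B := A.filter fun a => 4000 ≤ (keyClass A (· ∩ I) a).card with hB
  set D := A.filter fun a => ¬4000 ≤ (keyClass A (· ∩ I) a).card with hD
  have hBle : (B.card : ℝ) ≤ 2 * 2 ^ (556 * N) := by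
    refine card_le_of_sum_bad_le (hA.mono (filter_subset _ _)) N hι hI ?_
    have h0 : ∀ a ∈ B, (4000 : ℝ) ≤ (keyClass B (· ∩ I) a).card := ?_
    · exact (sum_not_pairDisjoint_le_of_le I (by norm_num) h0).trans_eq (by rw [hB]; norm_num)
    intro a ha
    have h : keyClass A (· ∩ I) a ⊆ keyClass B (· ∩ I) a := by
      intro b hb
      obtain ⟨hbA, hk⟩ := mem_filter.1 hb
      refine mem_filter.2 ⟨mem_filter.2 ⟨hbA, ?_⟩, hk⟩
      simp only at hk
      simp only [keyClass, hk]
      exact (mem_filter.1 ha).2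
    exact_mod_cast (mem_filter.1 ha).2.trans (card_le_card h)
  have hDle : (D.card : ℝ) ≤ 4000 * 2 ^ (556 * N) := by
    by_contra hcon
    rw [not_le] at hcon
    refine absurd ?_ (not_le.2 hcon)
    refine (card_le_of_sum_bad_le (hA.mono (filter_subset _ _)) N hι hI ?_).trans
      (by gcongr; norm_num)
    refine (sum_not_pairDisjoint_le_of_ge I (K := 4000) (by norm_num) fun a ha => ?_).trans ?_
    · have h : keyClass D (· ∩ I) a ⊆ keyClass A (· ∩ I) a :=
        filter_subset_filter _ (filter_subset _ _)
      have h1 := (card_le_card h).trans (le_of_lt (not_le.1 (mem_filter.1 ha).2))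
      exact_mod_cast h1
    · rw [hI]
      have h3 : (3 : ℝ) ^ (700 * N) ≤ (2 ^ (556 * N)) ^ 2 := by
        rw [← pow_mul, show 700 * N = 175 * (4 * N) by ring,
          show 556 * N * 2 = 278 * (4 * N) by ring, pow_mul 3, pow_mul 2 278]
        exact pow_le_pow_left₀ (by norm_num) (by norm_num) _
      have h4 : (4000 * 2 ^ (556 * N)) ^ 2 ≤ (D.card : ℝ) ^ 2 := by gcongr
      rw [mul_pow] at h4
      linarith
  have hsum : B.card + D.card = A.card := card_filter_add_card_filter_not _
  rw [← hsum]
  push_cast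
  linarith

lemma IsSignatureCode.eq_of_sum_eq {n t : ℕ} {C : Finset (Fin n → ℝ)} (hC : IsSignatureCode t C)
    {S S' : Multiset (Fin n → ℝ)} (hS : ∀ c ∈ S, c ∈ C) (hS' : ∀ c ∈ S', c ∈ C)
    (hcard : S.card = S'.card) (ht : S.card ≤ t) (hsum : S.sum = S'.sum) : S = S' := by
  have e1 : S - S' + S ∩ S' = S := Multiset.sub_add_inter S S'
  have e2 : S' - S + S ∩ S' = S' := by rw [Multiset.inter_comm]; exact Multiset.sub_add_inter S' S
  have hdisj : ∀ c ∈ S - S', c ∉ S' - S := by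
    intro c h1 h2
    have h3 := Multiset.count_pos.2 h1
    have h4 := Multiset.count_pos.2 h2
    rw [Multiset.count_sub] at h3 h4
    omega
  have hle : (S - S').card ≤ t := (Multiset.card_le_card (Multiset.sub_le_self S S')).trans ht
  have hU : ∀ c ∈ S - S', c ∈ C := fun c hc =>
    hS c (Multiset.mem_of_le (Multiset.sub_le_self S S') hc)
  have hU' : ∀ c ∈ S' - S, c ∈ C := fun c hc =>
    hS' c (Multiset.mem_of_le (Multiset.sub_le_self S' S) hc)
  have hc : (S - S').card = (S' - S).card := by
    have h1 := congrArg Multiset.card e1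
    have h2 := congrArg Multiset.card e2
    rw [Multiset.card_add] at h1 h2
    omega
  have hs : (S - S').sum = (S' - S).sum := by
    have h1 := congrArg Multiset.sum e1
    have h2 := congrArg Multiset.sum e2
    rw [Multiset.sum_add] at h1 h2
    exact add_right_cancel (h1.trans (hsum.trans h2.symm))
  generalize S - S' = U at *
  generalize S' - S = U' at *
  by_cases h0 : U = 0
  · subst h0
    rw [Multiset.card_zero] at hc
    rw [Multiset.card_eq_zero.1 hc.symm] at e2
    exact e1.symm.trans e2
  exfalso
  have hpos : 0 < U.card := Multiset.card_pos.2 h0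
  have hr : (0 : ℝ) < U.card := by exact_mod_cast hpos
  obtain ⟨c, hcU⟩ := Multiset.card_pos_iff_exists_mem.1 hpos
  have key : ∀ V : Multiset (Fin n → ℝ), V.card = U.card →
      1 ≤ V.toFinset.card ∧ V.toFinset.card ≤ t ∧
      (∀ c ∈ V.toFinset, 0 < (V.count c : ℝ) / U.card) ∧
      ∑ c ∈ V.toFinset, (V.count c : ℝ) / U.card = 1 ∧
      ∑ c ∈ V.toFinset, ((V.count c : ℝ) / U.card) • c = (1 / U.card : ℝ) • V.sum := by
    intro V hV
    refine ⟨?_, ?_, ?_, ?_, ?_⟩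
    · obtain ⟨c, hc⟩ := Multiset.card_pos_iff_exists_mem.1 (hV ▸ hpos)
      exact card_pos.2 ⟨c, Multiset.mem_toFinset.2 hc⟩
    · exact (Multiset.toFinset_card_le V).trans (hV ▸ hle)
    · intro c hc
      have := Multiset.count_pos.2 (Multiset.mem_toFinset.1 hc)
      positivity
    · rw [← sum_div, ← Nat.cast_sum, Multiset.toFinset_sum_count_eq, hV, div_self hr.ne']
    · rw [Finset.sum_multiset_count V, smul_sum]
      refine sum_congr rfl fun c _ => ?_
      rw [← Nat.cast_smul_eq_nsmul ℝ, smul_smul]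
      ring_nf
  obtain ⟨a1, a2, a3, a4, a5⟩ := key U rfl
  obtain ⟨b1, b2, b3, b4, b5⟩ := key U' hc.symm
  refine hC U.toFinset (fun c h => hU c (Multiset.mem_toFinset.1 h)) U'.toFinset
    (fun c h => hU' c (Multiset.mem_toFinset.1 h)) ?_ a1 a2 b1 b2 _ _ a3 b3 a4 b4
    (a5.trans (hs ▸ b5.symm))
  intro h
  have := Multiset.mem_toFinset.2 hcU
  rw [h, Multiset.mem_toFinset] at this
  exact hdisj c hcU this

/-- A signature code gives a family of supports with distinct sums. -/
lemma IsSignatureCode.exists_isSumDistinct {n t : ℕ} {C : Finset (Fin n → ℝ)}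
    (hb : IsBinaryCode C) (hC : IsSignatureCode t C) {ι : Type*} [DecidableEq ι]
    (e : Fin n ↪ ι) : ∃ A : Finset (Finset ι), IsSumDistinct t A ∧ A.card = C.card := by
  classical
  set supp : (Fin n → ℝ) → Finset ι := fun c => (univ.filter fun i => c i = 1).map e with hsupp
  set v : Finset ι → Fin n → ℝ := fun a i => if e i ∈ a then 1 else 0 with hv
  have hinv : ∀ c ∈ C, v (supp c) = c := by
    intro c hc
    ext i
    rcases hb c hc i with h | h <;> simp [hv, hsupp, h]
  have hmem : ∀ a ∈ C.image supp, v a ∈ C ∧ supp (v a) = a := by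
    intro a ha
    obtain ⟨c, hc, rfl⟩ := mem_image.1 ha
    rw [hinv c hc]
    exact ⟨hc, rfl⟩
  have hsum : ∀ (s : Multiset (Finset ι)) (i : Fin n),
      (s.map v).sum i = s.countP (fun a => e i ∈ a) := by
    intro s i
    induction s using Multiset.induction_on with
    | empty => simp
    | cons a s ih =>
      rw [Multiset.map_cons, Multiset.sum_cons, Pi.add_apply, ih, Multiset.countP_cons]
      by_cases h : e i ∈ a <;> simp [hv, h, add_comm]
  refine ⟨C.image supp, ?_, ?_⟩
  · intro s s' hs hs' hcard ht hcount
    have hback : ∀ u : Multiset (Finset ι), (∀ a ∈ u, a ∈ C.image supp) →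
        (u.map v).map supp = u := by
      intro u hu
      rw [Multiset.map_map]
      exact (Multiset.map_congr rfl fun a ha => (hmem a (hu a ha)).2).trans (Multiset.map_id u)
    have hvec : s.map v = s'.map v := by
      refine hC.eq_of_sum_eq ?_ ?_ (by simpa using hcard) (by simpa using ht) ?_
      · intro c hc
        obtain ⟨a, ha, rfl⟩ := Multiset.mem_map.1 hc
        exact (hmem a (hs a ha)).1
      · intro c hc
        obtain ⟨a, ha, rfl⟩ := Multiset.mem_map.1 hc
        exact (hmem a (hs' a ha)).1
      · ext i
        rw [hsum, hsum, hcount]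
    rw [← hback s hs, ← hback s' hs', hvec]
  · refine card_image_of_injOn fun c hc c' hc' h => ?_
    rw [← hinv c hc, ← hinv c' hc']
    exact congrArg v h

lemma IsSumDistinct.isSidonFamily {ι : Type*} [DecidableEq ι] {A : Finset (Finset ι)}
    (hA : IsSumDistinct 2 A) : IsSidonFamily A := by
  intro a ha b hb c hc d hd hab h1 h2
  have h : ({a, d} : Multiset (Finset ι)) = {c, b} := by
    refine hA _ _ ?_ ?_ rfl (le_of_eq rfl) ?_
    · intro w hw
      simp only [Multiset.insert_eq_cons, Multiset.mem_cons, Multiset.mem_singleton] at hw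
      rcases hw with rfl | rfl <;> assumption
    · intro w hw
      simp only [Multiset.insert_eq_cons, Multiset.mem_cons, Multiset.mem_singleton] at hw
      rcases hw with rfl | rfl <;> assumption
    · intro i
      have e1 := congrArg (i ∈ ·) h1
      have e2 := congrArg (i ∈ ·) h2
      simp only [mem_sdiff, eq_iff_iff] at e1 e2
      simp only [Multiset.insert_eq_cons, ← Multiset.cons_zero, Multiset.countP_cons,
        Multiset.countP_zero]
      by_cases i ∈ a <;> by_cases i ∈ b <;> by_cases i ∈ c <;> by_cases i ∈ d <;> simp_all
  rcases Multiset.pair_eq_pair h with h | h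
  · exact h.1
  · exact absurd h.1 hab

lemma Amax_le {n t N : ℕ} (hn : n ≤ 1250 * N) {B : ℝ}
    (hB : ∀ A : Finset (Finset (Fin (1250 * N))), IsSumDistinct t A → (A.card : ℝ) ≤ B) :
    (Amax n t : ℝ) ≤ B := by
  have hB0 : 0 ≤ B := by
    refine (Nat.cast_nonneg _).trans (hB ∅ ?_)
    intro s s' hs hs' _ _ _
    rw [Multiset.eq_zero_of_forall_notMem fun a ha => absurd (hs a ha) (notMem_empty a),
      Multiset.eq_zero_of_forall_notMem fun a ha => absurd (hs' a ha) (notMem_empty a)]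
  rw [← Nat.le_floor_iff hB0]
  refine csSup_le ⟨0, ∅, ?_, ?_, rfl⟩ ?_
  · intro c hc
    exact absurd hc (notMem_empty c)
  · intro C₁ h1 C₂ _ _ hpos
    rw [subset_empty.1 h1, card_empty] at hpos
    omega
  · rintro M ⟨C, hb, hC, rfl⟩
    obtain ⟨A, hA, hcard⟩ := hC.exists_isSumDistinct hb (Fin.castLEEmb hn)
    rw [← hcard]
    exact Nat.le_floor (hB A hA)

/-- Exponential bounds along multiples of `1250` bound the rate. -/
lemma limsup_logb_div_le {f : ℕ → ℕ} {K ρ : ℝ} {r : ℕ} (hK : 0 < K) (hρ : (r : ℝ) / 1250 < ρ)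
    (hf : ∀ n N : ℕ, 0 < N → n ≤ 1250 * N → (f n : ℝ) ≤ K * (1250 * N + 1) * 2 ^ (r * N)) :
    Filter.atTop.limsup (fun n : ℕ => Real.logb 2 (f n) / n) ≤ ρ := by
  have hnonneg : ∀ m : ℕ, 0 ≤ Real.logb 2 (m : ℝ) := by
    intro m
    rcases Nat.eq_zero_or_pos m with rfl | hm
    · simp
    · exact Real.logb_nonneg (by norm_num) (by exact_mod_cast hm)
  have hρ0 : 0 ≤ ρ := le_trans (by positivity) hρ.le
  refine Filter.limsup_le_of_le
    (Filter.isCoboundedUnder_le_of_le Filter.atTop (x := 0) fun n =>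
      div_nonneg (hnonneg _) (Nat.cast_nonneg n)) ?_
  have hlog : Filter.Tendsto (fun n : ℕ => Real.log n / n) Filter.atTop (nhds 0) :=
    Real.isLittleO_log_id_atTop.tendsto_div_nhds_zero.comp tendsto_natCast_atTop_atTop
  have hinv : Filter.Tendsto (fun n : ℕ => (Real.logb 2 (K * 1252) + r) / (n : ℝ)) Filter.atTop
      (nhds 0) := tendsto_const_div_atTop_nhds_zero_nat _
  have hlim := (hinv.add (hlog.const_mul (1 / Real.log 2))).add_const ((r : ℝ) / 1250)
  simp only [mul_zero, add_zero, zero_add] at hlim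
  filter_upwards [hlim.eventually_lt_const hρ, Filter.eventually_gt_atTop 0] with n hn hn0
  have hnR : (1 : ℝ) ≤ n := by exact_mod_cast hn0
  rcases Nat.eq_zero_or_pos (f n) with h0 | hpos
  · simpa [h0] using hρ0
  have hposR : (0 : ℝ) < f n := by exact_mod_cast hpos
  refine le_trans ?_ hn.le
  set N := n / 1250 + 1 with hN
  have hN1 : n ≤ 1250 * N := by omega
  have hN2 : 1250 * (N : ℝ) ≤ n + 1250 := by
    have : 1250 * N ≤ n + 1250 := by omega
    exact_mod_cast this
  have h1 := hf n N (by omega) hN1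
  have h2 : (f n : ℝ) ≤ K * 1252 * n * 2 ^ (r * N) := by
    refine h1.trans ?_
    rw [mul_assoc K 1252]
    have h5 : 1250 * (N : ℝ) + 1 ≤ 1252 * n := by linarith
    gcongr
  have h3 := Real.logb_le_logb_of_le (by norm_num : (1 : ℝ) < 2) hposR h2
  rw [Real.logb_mul (by positivity) (by positivity), Real.logb_mul (by positivity) (by positivity),
    Real.logb_pow, Real.logb_self_eq_one (by norm_num)] at h3
  have h4 : (r : ℝ) * N ≤ r / 1250 * n + r := by
    have := mul_le_mul_of_nonneg_left hN2 (Nat.cast_nonneg r : (0 : ℝ) ≤ r)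
    linarith
  have e : (Real.logb 2 (K * 1252) + r) / (n : ℝ) + 1 / Real.log 2 * (Real.log n / n) + r / 1250 =
      (Real.logb 2 (K * 1252) + r + Real.logb 2 n + r / 1250 * n) / n := by
    rw [Real.logb, Real.logb]
    field_simp
  rw [e]
  gcongr
  push_cast at h3
  linarith

theorem stmt_8 :
    Filter.atTop.limsup (fun n : ℕ => Real.logb 2 (Amax n 2) / n) ≤ 0.5753 ∧
    Filter.atTop.limsup (fun n : ℕ => Real.logb 2 (Amax n 4) / n) ≤ 0.4451 := by
  constructor
  · refine limsup_logb_div_le (K := 3008 * (622 / 3) ^ 14) (r := 719) (by positivity)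
      (by norm_num) fun n N hN hn => Amax_le hn fun A hA => ?_
    exact sidon_card_le N hN (Fintype.card_fin _) hA.isSidonFamily
  · refine limsup_logb_div_le (K := 4002) (r := 556) (by positivity) (by norm_num)
      fun n N hN hn => Amax_le hn fun A hA => ?_
    refine (sumDistinct_four_card_le hA N (Fintype.card_fin _)).trans ?_
    gcongr
    have : (0 : ℝ) ≤ 1250 * N := by positivity
    linarith
end

section
/- Let n ≥ 2 be an integer and let C be a binary code of length n with constant weight 2. Let G be the simple graph on vertex set {1,…,n} in which distinct vertices i and j are adjacent if and only if there exists a codeword c ∈ C with supp(c) = {i,j}. Then C is a 2-signature code if and only if G is C₄-free, i.e., there do not exist four pairwise distinct vertices a, b, c, d with a adjacent to b, b adjacent to c, c adjacent to d, and d adjacent to a. -/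
open Finset

/-- The graph on coordinates `{1,…,n}` whose edges are the supports of the
weight-2 codewords of `C`. -/
def codeGraph {n : ℕ} (C : Finset (Fin n → ℝ)) : SimpleGraph (Fin n) :=
  SimpleGraph.fromRel (fun i j => ∃ c ∈ C, {k | c k = 1} = ({i, j} : Set (Fin n)))

namespace IsBinaryCode

variable {n : ℕ} {C : Finset (Fin n → ℝ)}

/-- Codewords of a binary code are determined by their supports. -/
lemma eq_of_support_eq (hbin : IsBinaryCode C) {x y : Fin n → ℝ} (hx : x ∈ C) (hy : y ∈ C)
    (h : ∀ i, x i = 1 ↔ y i = 1) : x = y := by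
  funext i
  have := h i
  rcases hbin x hx i with h0 | h0 <;> rcases hbin y hy i with h1 | h1 <;> simp_all

/-- Equal positive convex combinations of two pairs of codewords have supports with the same
union and the same intersection. -/
lemma support_of_combination_eq (hbin : IsBinaryCode C) {x y z w : Fin n → ℝ}
    (hx : x ∈ C) (hy : y ∈ C) (hz : z ∈ C) (hw : w ∈ C) {p q r s : ℝ}
    (hp : 0 < p) (hq : 0 < q) (hr : 0 < r) (hs : 0 < s) (hpq : p + q = 1) (hrs : r + s = 1)
    (h : p • x + q • y = r • z + s • w) (i : Fin n) :
    (x i = 1 ∨ y i = 1 ↔ z i = 1 ∨ w i = 1) ∧ (x i = 1 ∧ y i = 1 ↔ z i = 1 ∧ w i = 1) := by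
  have hi := congrFun h i
  simp only [Pi.add_apply, Pi.smul_apply, smul_eq_mul] at hi
  rcases hbin x hx i with h0 | h0 <;> rcases hbin y hy i with h1 | h1 <;>
    rcases hbin z hz i with h2 | h2 <;> rcases hbin w hw i with h3 | h3 <;>
    simp only [h0, h1, h2, h3, mul_zero, mul_one] at hi ⊢ <;> first | (norm_num; done) | linarith

end IsBinaryCode

section codeGraph

variable {n : ℕ} {C : Finset (Fin n → ℝ)}

lemma codeGraph_adj_iff {i j : Fin n} :
    (codeGraph C).Adj i j ↔ i ≠ j ∧ ∃ c ∈ C, ∀ k, c k = 1 ↔ k = i ∨ k = j := by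
  rw [codeGraph, SimpleGraph.fromRel_adj, Set.pair_comm j i, or_self]
  simp only [Set.ext_iff, Set.mem_ofPred_eq, Set.mem_insert_iff, Set.mem_singleton_iff]

lemma exists_support_eq_pair {x : Fin n → ℝ} (hx : ({k | x k = 1} : Set (Fin n)).ncard = 2)
    {a : Fin n} (ha : x a = 1) : ∃ b, a ≠ b ∧ ∀ k, x k = 1 ↔ k = a ∨ k = b := by
  obtain ⟨u, v, huv, h⟩ := Set.ncard_eq_two.mp hx
  have h' : ∀ k, x k = 1 ↔ k = u ∨ k = v := fun k => by simpa using Set.ext_iff.mp h k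
  rcases (h' a).mp ha with rfl | rfl
  · exact ⟨v, huv, h'⟩
  · exact ⟨u, huv.symm, fun k => (h' k).trans or_comm⟩

/-- If the supports of `x, y` and of `z, w` have the same union and intersection, and the two
elements of the support of `x` are split between `z` and `w`, then the graph has a 4-cycle. -/
lemma exists_four_cycle_of_mem (hwt : ∀ c ∈ C, ({k | c k = 1} : Set (Fin n)).ncard = 2)
    {x y z w : Fin n → ℝ} (hx : x ∈ C) (hy : y ∈ C) (hz : z ∈ C) (hw : w ∈ C)
    (h : ∀ i, (x i = 1 ∨ y i = 1 ↔ z i = 1 ∨ w i = 1) ∧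
      (x i = 1 ∧ y i = 1 ↔ z i = 1 ∧ w i = 1))
    {a b : Fin n} (hab : a ≠ b) (hxs : ∀ k, x k = 1 ↔ k = a ∨ k = b)
    (hza : z a = 1) (hwa : w a ≠ 1) (hzb : z b ≠ 1) (hwb : w b = 1) :
    ∃ a b c d : Fin n,
      a ≠ b ∧ a ≠ c ∧ a ≠ d ∧ b ≠ c ∧ b ≠ d ∧ c ≠ d ∧
      (codeGraph C).Adj a b ∧ (codeGraph C).Adj b c ∧
      (codeGraph C).Adj c d ∧ (codeGraph C).Adj d a := by
  obtain ⟨c, hac, hzs⟩ := exists_support_eq_pair (hwt z hz) hza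
  obtain ⟨d, hbd, hws⟩ := exists_support_eq_pair (hwt w hw) hwb
  have hzc : z c = 1 := (hzs c).mpr (Or.inr rfl)
  have hwd : w d = 1 := (hws d).mpr (Or.inr rfl)
  have hbc : b ≠ c := by rintro rfl; exact hzb hzc
  have had : a ≠ d := by rintro rfl; exact hwa hwd
  have hxc : x c ≠ 1 := fun e => ((hxs c).mp e).elim hac.symm hbc.symm
  have hxd : x d ≠ 1 := fun e => ((hxs d).mp e).elim had.symm hbd.symm
  have hyc : y c = 1 := ((h c).1.mpr (Or.inl hzc)).resolve_left hxc
  have hyd : y d = 1 := ((h d).1.mpr (Or.inr hwd)).resolve_left hxd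
  have hdc : d ≠ c := by
    rintro rfl
    exact hxd ((h d).2.mpr ⟨hzc, hwd⟩).1
  obtain ⟨e, hde, hys⟩ := exists_support_eq_pair (hwt y hy) hyd
  obtain rfl : c = e := ((hys c).mp hyc).resolve_left hdc.symm
  exact ⟨a, b, d, c, hab, had, hac, hbd, hbc, hdc,
    codeGraph_adj_iff.mpr ⟨hab, x, hx, hxs⟩, codeGraph_adj_iff.mpr ⟨hbd, w, hw, hws⟩,
    codeGraph_adj_iff.mpr ⟨hdc, y, hy, hys⟩,
    codeGraph_adj_iff.mpr ⟨hac.symm, z, hz, fun k => (hzs k).trans or_comm⟩⟩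

lemma eq_or_eq_of_four_cycle_free (hbin : IsBinaryCode C)
    (hwt : ∀ c ∈ C, ({k | c k = 1} : Set (Fin n)).ncard = 2)
    (hfree : ¬ ∃ a b c d : Fin n,
      a ≠ b ∧ a ≠ c ∧ a ≠ d ∧ b ≠ c ∧ b ≠ d ∧ c ≠ d ∧
      (codeGraph C).Adj a b ∧ (codeGraph C).Adj b c ∧
      (codeGraph C).Adj c d ∧ (codeGraph C).Adj d a)
    {x y z w : Fin n → ℝ} (hx : x ∈ C) (hy : y ∈ C) (hz : z ∈ C) (hw : w ∈ C)
    (h : ∀ i, (x i = 1 ∨ y i = 1 ↔ z i = 1 ∨ w i = 1) ∧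
      (x i = 1 ∧ y i = 1 ↔ z i = 1 ∧ w i = 1)) : x = z ∨ x = w := by
  obtain ⟨a, ha⟩ := Set.nonempty_of_ncard_ne_zero (by rw [hwt x hx]; norm_num)
  obtain ⟨b, hab, hxs⟩ := exists_support_eq_pair (hwt x hx) ha
  have eq_of_mem : ∀ v ∈ C, v a = 1 → v b = 1 → x = v := by
    intro v hv hva hvb
    obtain ⟨e, hae, hvs⟩ := exists_support_eq_pair (hwt v hv) hva
    obtain rfl : b = e := ((hvs b).mp hvb).resolve_left hab.symm
    exact hbin.eq_of_support_eq hx hv fun k => (hxs k).trans (hvs k).symm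
  by_contra! hne
  have hz' : z a = 1 → z b ≠ 1 := fun e e' => hne.1 (eq_of_mem z hz e e')
  have hw' : w a = 1 → w b ≠ 1 := fun e e' => hne.2 (eq_of_mem w hw e e')
  have hb : z b = 1 ∨ w b = 1 := (h b).1.mp (Or.inl ((hxs b).mpr (Or.inr rfl)))
  rcases (h a).1.mp (Or.inl ha) with hza | hwa
  · have hwb := hb.resolve_left (hz' hza)
    exact hfree (exists_four_cycle_of_mem hwt hx hy hz hw h hab hxs hza
      (fun e => hw' e hwb) (hz' hza) hwb)
  · have hzb := hb.resolve_right (hw' hwa)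
    refine hfree (exists_four_cycle_of_mem hwt hx hy hw hz (fun i => ?_) hab hxs hwa
      (fun e => hz' e hzb) (hw' hwa) hzb)
    exact ⟨(h i).1.trans or_comm, (h i).2.trans and_comm⟩

end codeGraph

/-- A positive convex combination of at most two vectors, written with exactly two terms. -/
lemma exists_pair_combination {V : Type*} [AddCommGroup V] [Module ℝ V] [DecidableEq V]
    {S : Finset V} (h1 : 1 ≤ S.card) (h2 : S.card ≤ 2) {lam : V → ℝ}
    (hpos : ∀ c ∈ S, 0 < lam c) (hsum : ∑ c ∈ S, lam c = 1) :
    ∃ x y, S = {x, y} ∧ ∃ p q : ℝ, 0 < p ∧ 0 < q ∧ p + q = 1 ∧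
      ∑ c ∈ S, lam c • c = p • x + q • y := by
  obtain hS | hS : S.card = 1 ∨ S.card = 2 := by omega
  · obtain ⟨x, rfl⟩ := Finset.card_eq_one.mp hS
    rw [Finset.sum_singleton] at hsum
    refine ⟨x, x, by simp, 1 / 2, 1 / 2, by norm_num, by norm_num, by norm_num, ?_⟩
    rw [Finset.sum_singleton, hsum, ← add_smul]
    norm_num
  · obtain ⟨x, y, hxy, rfl⟩ := Finset.card_eq_two.mp hS
    rw [Finset.sum_pair hxy] at hsum
    exact ⟨x, y, rfl, lam x, lam y, hpos x (by simp), hpos y (by simp), hsum,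
      Finset.sum_pair hxy⟩

theorem stmt_9 (n : ℕ) (hn : 2 ≤ n)
    (C : Finset (Fin n → ℝ)) (hbin : IsBinaryCode C)
    (hwt : ∀ c ∈ C, ({k | c k = 1} : Set (Fin n)).ncard = 2) :
    IsSignatureCode 2 C ↔
      ¬ ∃ a b c d : Fin n,
          a ≠ b ∧ a ≠ c ∧ a ≠ d ∧ b ≠ c ∧ b ≠ d ∧ c ≠ d ∧
          (codeGraph C).Adj a b ∧ (codeGraph C).Adj b c ∧
          (codeGraph C).Adj c d ∧ (codeGraph C).Adj d a := by
  classical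
  constructor
  · rintro hsig ⟨a, b, c, d, hab, hac, had, hbc, hbd, hcd, h1, h2, h3, h4⟩
    obtain ⟨-, x, hx, hxs⟩ := codeGraph_adj_iff.mp h1
    obtain ⟨-, z, hz, hzs⟩ := codeGraph_adj_iff.mp h2
    obtain ⟨-, y, hy, hys⟩ := codeGraph_adj_iff.mp h3
    obtain ⟨-, w, hw, hws⟩ := codeGraph_adj_iff.mp h4
    have ne_of_apply {u v : Fin n → ℝ} (k : Fin n) (hu : u k = 1) (hv : ¬ v k = 1) : u ≠ v := by
      rintro rfl
      exact hv hu
    have hxy : x ≠ y := ne_of_apply a (by simp [hxs]) (by simp [hys, hac, had])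
    have hzw : z ≠ w := ne_of_apply b (by simp [hzs]) (by simp [hws, hbd, hab.symm])
    have hxz : x ≠ z := ne_of_apply a (by simp [hxs]) (by simp [hzs, hab, hac])
    have hxw : x ≠ w := ne_of_apply b (by simp [hxs]) (by simp [hws, hbd, hab.symm])
    refine hsig {x, y} (by simp [Finset.insert_subset_iff, hx, hy])
      {z, w} (by simp [Finset.insert_subset_iff, hz, hw]) ?_ (by simp [Finset.card_pair hxy])
      (by simp [Finset.card_pair hxy]) (by simp [Finset.card_pair hzw])
      (by simp [Finset.card_pair hzw]) (fun _ => 1 / 2) (fun _ => 1 / 2)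
      (fun _ _ => by norm_num) (fun _ _ => by norm_num)
      (by rw [Finset.sum_pair hxy]; norm_num) (by rw [Finset.sum_pair hzw]; norm_num) ?_
    · intro e
      have : x ∈ ({z, w} : Finset (Fin n → ℝ)) := e ▸ Finset.mem_insert_self x {y}
      simp [hxz, hxw] at this
    · rw [Finset.sum_pair hxy, Finset.sum_pair hzw, ← smul_add, ← smul_add]
      congr 1
      have apply_eq {v : Fin n → ℝ} (hv : v ∈ C) {i j : Fin n}
          (hs : ∀ k, v k = 1 ↔ k = i ∨ k = j) (k : Fin n) :
          v k = if k = i ∨ k = j then 1 else 0 := by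
        split_ifs with hk
        · exact (hs k).mpr hk
        · exact (hbin v hv k).resolve_right fun e => hk ((hs k).mp e)
      funext k
      simp only [Pi.add_apply, apply_eq hx hxs, apply_eq hy hys, apply_eq hz hzs,
        apply_eq hw hws]
      grind
  · intro hfree C₁ hC₁ C₂ hC₂ hne h1 h1' h2 h2' lam mu hlam hmu hlam1 hmu1 heq
    obtain ⟨x, y, rfl, p, q, hp, hq, hpq, e₁⟩ := exists_pair_combination h1 h1' hlam hlam1
    obtain ⟨z, w, rfl, r, s, hr, hs, hrs, e₂⟩ := exists_pair_combination h2 h2' hmu hmu1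
    rw [e₁, e₂] at heq
    have hx : x ∈ C := hC₁ (by simp)
    have hy : y ∈ C := hC₁ (by simp)
    have hz : z ∈ C := hC₂ (by simp)
    have hw : w ∈ C := hC₂ (by simp)
    have h := hbin.support_of_combination_eq hx hy hz hw hp hq hr hs hpq hrs heq
    have hx' := eq_or_eq_of_four_cycle_free hbin hwt hfree hx hy hz hw h
    have hy' := eq_or_eq_of_four_cycle_free hbin hwt hfree hy hx hz hw fun i =>
      ⟨or_comm.trans (h i).1, and_comm.trans (h i).2⟩
    have hz' := eq_or_eq_of_four_cycle_free hbin hwt hfree hz hw hx hy fun i =>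
      ⟨(h i).1.symm, (h i).2.symm⟩
    have hw' := eq_or_eq_of_four_cycle_free hbin hwt hfree hw hz hx hy fun i =>
      ⟨or_comm.trans (h i).1.symm, and_comm.trans (h i).2.symm⟩
    apply hne
    apply Finset.Subset.antisymm <;> simp [Finset.insert_subset_iff, hx', hy', hz', hw']
end

section
/- Let n ≥ 3 be an integer, let C be a binary code of length n with constant weight 3, and let F = {supp(c) : c ∈ C} be the corresponding family of 3-subsets of {1,…,n}. For a 2-subset A ⊆ {1,…,n}, let T(A) = {z ∈ {1,…,n} : A ∪ {z} ∈ F}. Then C is a 2-signature code if and only if |T(A) ∩ T(A')| ≤ 1 for any two distinct 2-subsets A, A' of {1,…,n}. -/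
/-- If two nondegenerate convex combinations of two binary vectors agree and the first pair is
distinct, then the pairs agree up to order or have equal sums. -/
lemma binary_pair_convex_comb_eq {n : ℕ} {a b c d : Fin n → ℝ}
    (ha : ∀ i, a i = 0 ∨ a i = 1) (hb : ∀ i, b i = 0 ∨ b i = 1)
    (hc : ∀ i, c i = 0 ∨ c i = 1) (hd : ∀ i, d i = 0 ∨ d i = 1) (hab : a ≠ b)
    {p q r s : ℝ} (hp : 0 < p) (hq : 0 < q) (hr : 0 < r) (hs : 0 < s)
    (hpq : p + q = 1) (hrs : r + s = 1)
    (h : ∀ i, p * a i + q * b i = r * c i + s * d i) :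
    (a = c ∧ b = d) ∨ (a = d ∧ b = c) ∨ ∀ i, a i + b i = c i + d i := by
  obtain ⟨i, hi⟩ := Function.ne_iff.1 hab
  have hpr : p = r ∨ p = s := by
    have := h i
    rcases ha i with h1 | h1 <;> rcases hb i with h2 | h2 <;> rcases hc i with h3 | h3 <;>
      rcases hd i with h4 | h4 <;> rw [h1, h2] at hi <;> rw [h1, h2, h3, h4] at this <;> grind
  by_cases hhalf : p = 1 / 2
  · right; right
    intro j
    have := h j
    have h1 : q = 1 / 2 := by linarith
    have h2 : r = 1 / 2 ∧ s = 1 / 2 := by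
      rcases hpr with h | h <;> constructor <;> linarith
    rw [hhalf, h1, h2.1, h2.2] at this
    linarith
  · rcases hpr with hpr | hpr
    · left
      have key : ∀ j, a j = c j ∧ b j = d j := by
        intro j
        have := h j
        rcases ha j with h1 | h1 <;> rcases hb j with h2 | h2 <;> rcases hc j with h3 | h3 <;>
          rcases hd j with h4 | h4 <;> rw [h1, h2, h3, h4] at this <;> grind
      exact ⟨funext fun j => (key j).1, funext fun j => (key j).2⟩
    · right; left
      have key : ∀ j, a j = d j ∧ b j = c j := by
        intro j
        have := h j
        rcases ha j with h1 | h1 <;> rcases hb j with h2 | h2 <;> rcases hc j with h3 | h3 <;>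
          rcases hd j with h4 | h4 <;> rw [h1, h2, h3, h4] at this <;> grind
      exact ⟨funext fun j => (key j).1, funext fun j => (key j).2⟩

/-- A binary vector is not a proper convex combination of two distinct binary vectors. -/
lemma binary_ne_convex_comb {n : ℕ} {a c d : Fin n → ℝ}
    (ha : ∀ i, a i = 0 ∨ a i = 1) (hc : ∀ i, c i = 0 ∨ c i = 1) (hd : ∀ i, d i = 0 ∨ d i = 1)
    (hcd : c ≠ d) {r s : ℝ} (hr : 0 < r) (hs : 0 < s) (hrs : r + s = 1) :
    ¬ ∀ i, a i = r * c i + s * d i := by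
  intro h
  obtain ⟨i, hi⟩ := Function.ne_iff.1 hcd
  have := h i
  rcases ha i with h1 | h1 <;> rcases hc i with h2 | h2 <;> rcases hd i with h3 | h3 <;>
    rw [h2, h3] at hi <;> rw [h1, h2, h3] at this <;> grind

lemma binary_ext {n : ℕ} {a c : Fin n → ℝ}
    (ha : ∀ i, a i = 0 ∨ a i = 1) (hc : ∀ i, c i = 0 ∨ c i = 1)
    (h : ∀ i, a i = 1 ↔ c i = 1) : a = c := by
  funext i
  have := h i
  rcases ha i with h1 | h1 <;> rcases hc i with h2 | h2 <;> simp_all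

/-- If `a + b = c + d` for codewords with `a ≠ d` and `supp a \ supp c = {x}`, then two distinct
2-subsets have two common completions. -/
lemma exists_common_completions_of_sdiff_eq_singleton {n : ℕ} {a b c d : Fin n → ℝ}
    (ha : ∀ i, a i = 0 ∨ a i = 1) (hb : ∀ i, b i = 0 ∨ b i = 1)
    (hc : ∀ i, c i = 0 ∨ c i = 1) (hd : ∀ i, d i = 0 ∨ d i = 1)
    (wa : ({k | a k = 1} : Set (Fin n)).ncard = 3) (wb : ({k | b k = 1} : Set (Fin n)).ncard = 3)
    (wc : ({k | c k = 1} : Set (Fin n)).ncard = 3)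
    (had : a ≠ d) (h : ∀ i, a i + b i = c i + d i)
    (hx : ({k | a k = 1} \ {k | c k = 1} : Set (Fin n)).ncard = 1) :
    ∃ A A' : Set (Fin n), ∃ x y, A.ncard = 2 ∧ A'.ncard = 2 ∧ A ≠ A' ∧ x ≠ y ∧
      {k | a k = 1} = A ∪ {x} ∧ {k | b k = 1} = A' ∪ {y} ∧
      {k | c k = 1} = A ∪ {y} ∧ {k | d k = 1} = A' ∪ {x} := by
  have hy : ({k | c k = 1} \ {k | a k = 1} : Set (Fin n)).ncard = 1 := by
    have h1 := Set.ncard_sdiff_add_ncard {k | a k = 1} {k | c k = 1}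
    have h2 := Set.ncard_sdiff_add_ncard {k | c k = 1} {k | a k = 1}
    rw [Set.union_comm] at h2
    omega
  obtain ⟨x, hx⟩ := Set.ncard_eq_one.1 hx
  obtain ⟨y, hy⟩ := Set.ncard_eq_one.1 hy
  simp only [Set.ext_iff, Set.mem_sdiff, Set.mem_ofPred_eq, Set.mem_singleton_iff] at hx hy
  obtain ⟨ax, cx⟩ := (hx x).2 rfl
  obtain ⟨cy, ay⟩ := (hy y).2 rfl
  have cx := (hc x).resolve_right cx
  have ay := (ha y).resolve_right ay
  have hxy : x ≠ y := by rintro rfl; linarith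
  have hX := h x
  have hY := h y
  have dx : d x = 1 := by rcases hb x with h1 | h1 <;> rcases hd x with h2 | h2 <;> linarith
  have bx : b x = 0 := by linarith
  have bY : b y = 1 := by rcases hb y with h1 | h1 <;> rcases hd y with h2 | h2 <;> linarith
  have dy : d y = 0 := by linarith
  have hac : ∀ k, k ≠ x → k ≠ y → a k = c k := by
    intro k h1 h2
    have := hx k
    have := hy k
    rcases ha k with h3 | h3 <;> rcases hc k with h4 | h4 <;> simp_all
  have hbd : ∀ k, k ≠ x → k ≠ y → b k = d k := fun k h1 h2 => by
    linarith [h k, hac k h1 h2]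
  have hA : {k | a k = 1} = ({k | a k = 1} \ {x}) ∪ {x} := by
    rw [Set.sdiff_union_self, Set.union_eq_left.2]; simpa using ax
  have hD : {k | d k = 1} = ({k | b k = 1} \ {y}) ∪ {x} := by
    ext k
    by_cases h1 : k = x
    · simp [h1, dx]
    · by_cases h2 : k = y
      · simp [h2, dy, hxy.symm]
      · simp [h1, h2, hbd k h1 h2]
  refine ⟨{k | a k = 1} \ {x}, {k | b k = 1} \ {y}, x, y, ?_, ?_, ?_, hxy, hA, ?_, ?_, hD⟩
  · rw [Set.ncard_sdiff_singleton_of_mem (by simpa using ax), wa]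
  · rw [Set.ncard_sdiff_singleton_of_mem (by simpa using bY), wb]
  · intro he
    rw [← he, ← hA] at hD
    exact had (binary_ext ha hd fun i => (Set.ext_iff.1 hD i).symm)
  · rw [Set.sdiff_union_self, Set.union_eq_left.2]; simpa using bY
  · ext k
    by_cases h1 : k = x
    · simp [h1, cx, hxy]
    · by_cases h2 : k = y
      · simp [h2, cy]
      · simp [h1, h2, hac k h1 h2]

/-- Two different pairs of weight-3 binary vectors with equal sums contain, after possibly
exchanging the second pair, two vectors whose supports differ in one element. -/
lemma ncard_support_sdiff_eq_one_or {n : ℕ} {a b c d : Fin n → ℝ}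
    (ha : ∀ i, a i = 0 ∨ a i = 1) (hb : ∀ i, b i = 0 ∨ b i = 1)
    (hc : ∀ i, c i = 0 ∨ c i = 1) (hd : ∀ i, d i = 0 ∨ d i = 1)
    (wa : ({k | a k = 1} : Set (Fin n)).ncard = 3)
    (wc : ({k | c k = 1} : Set (Fin n)).ncard = 3)
    (wd : ({k | d k = 1} : Set (Fin n)).ncard = 3)
    (hac : a ≠ c) (had : a ≠ d) (h : ∀ i, a i + b i = c i + d i) :
    ({k | a k = 1} \ {k | c k = 1} : Set (Fin n)).ncard = 1 ∨
      ({k | a k = 1} \ {k | d k = 1} : Set (Fin n)).ncard = 1 := by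
  have pos : ∀ e : Fin n → ℝ, (∀ i, e i = 0 ∨ e i = 1) →
      ({k | e k = 1} : Set (Fin n)).ncard = 3 → a ≠ e →
      ({k | a k = 1} \ {k | e k = 1} : Set (Fin n)).ncard ≠ 0 := by
    intro e he we hae h0
    rw [Set.ncard_eq_zero, Set.sdiff_eq_empty] at h0
    have := Set.eq_of_subset_of_ncard_le h0 (by omega)
    exact hae (binary_ext ha he fun i => Set.ext_iff.1 this i)
  have h1 := pos c hc wc hac
  have h2 := pos d hd wd had
  have hdis : Disjoint ({k | a k = 1} \ {k | c k = 1} : Set (Fin n))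
      ({k | a k = 1} \ {k | d k = 1}) := by
    rw [Set.disjoint_left]
    rintro k ⟨h3, h4⟩ ⟨-, h5⟩
    have h3 : a k = 1 := h3
    have h4 := (hc k).resolve_right h4
    have h5 := (hd k).resolve_right h5
    have := h k
    rcases hb k with h6 | h6 <;> linarith
  have h3 := Set.ncard_union_eq hdis
  have h4 := Set.ncard_le_ncard
    (Set.union_subset (Set.sdiff_subset (s := {k | a k = 1}) (t := {k | c k = 1}))
      (Set.sdiff_subset (s := {k | a k = 1}) (t := {k | d k = 1})))
  omega


open Finset

theorem stmt_11 (n : ℕ) (hn : 3 ≤ n)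
    (C : Finset (Fin n → ℝ)) (hbin : IsBinaryCode C)
    (hwt : ∀ c ∈ C, ({k | c k = 1} : Set (Fin n)).ncard = 3) :
    -- `F` is the family of supports, `T A = {z : A ∪ {z} ∈ F}`
    (let F : Set (Set (Fin n)) := {S | ∃ c ∈ C, {k | c k = 1} = S};
     let T : Set (Fin n) → Set (Fin n) := fun A => {z | A ∪ {z} ∈ F};
     IsSignatureCode 2 C ↔
       ∀ A A' : Set (Fin n), A.ncard = 2 → A'.ncard = 2 → A ≠ A' →
         (T A ∩ T A').ncard ≤ 1) := by
  intro F T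
  constructor
  · intro hsig A A' hA hA' hne
    by_contra! hcon
    obtain ⟨x, y, ⟨hxA, hxA'⟩, ⟨hyA, hyA'⟩, hxy⟩ := (Set.one_lt_ncard_iff (Set.toFinite _)).1 hcon
    obtain ⟨a, haC, ha⟩ := hxA
    obtain ⟨c, hcC, hc⟩ := hyA
    obtain ⟨d, hdC, hd⟩ := hxA'
    obtain ⟨b, hbC, hb⟩ := hyA'
    have notMem : ∀ (B : Set (Fin n)) (z : Fin n) (e : Fin n → ℝ), B.ncard = 2 → e ∈ C →
        {k | e k = 1} = B ∪ {z} → z ∉ B := by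
      intro B z e hB he h hz
      have h3 := hwt e he
      rw [h, Set.union_eq_left.2 (by simpa using hz), hB] at h3
      omega
    have xA := notMem A x a hA haC ha
    have yA := notMem A y c hA hcC hc
    have xA' := notMem A' x d hA' hdC hd
    have yA' := notMem A' y b hA' hbC hb
    simp only [Set.ext_iff, Set.mem_ofPred_eq, Set.mem_union, Set.mem_singleton_iff] at ha hb hc hd
    have hab : a ≠ b := by rintro rfl; grind
    have hcd : c ≠ d := by rintro rfl; grind
    have hac : a ≠ c := by rintro rfl; grind
    have had : a ≠ d := by
      rintro rfl
      refine hne (Set.ext fun k => ?_)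
      grind
    have hsum : ∀ k, a k + b k = c k + d k := by
      intro k
      have h1 := ha k
      have h2 := hb k
      have h3 := hc k
      have h4 := hd k
      have e1 := hbin a haC k
      have e2 := hbin b hbC k
      have e3 := hbin c hcC k
      have e4 := hbin d hdC k
      grind
    refine hsig {a, b} (by simp [insert_subset_iff, haC, hbC]) {c, d}
      (by simp [insert_subset_iff, hcC, hdC]) ?_ (by simp [card_pair hab])
      (by simp [card_pair hab]) (by simp [card_pair hcd]) (by simp [card_pair hcd])
      (fun _ => 1 / 2) (fun _ => 1 / 2) (by simp) (by simp) ?_ ?_ ?_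
    · intro he
      have : a ∈ ({c, d} : Finset (Fin n → ℝ)) := he ▸ mem_insert_self a _
      simp [hac, had] at this
    · rw [sum_pair hab]; norm_num
    · rw [sum_pair hcd]; norm_num
    · rw [sum_pair hab, sum_pair hcd, ← smul_add, ← smul_add]
      congr 1
      exact funext hsum
  · intro hT C₁ hC₁ C₂ hC₂ hne h1 h1' h2 h2' lam mu hlam hmu hl hm heq
    have viol : ∀ a ∈ C, ∀ b ∈ C, ∀ c ∈ C, ∀ d ∈ C, a ≠ d →
        (∀ i, a i + b i = c i + d i) →
        ({k | a k = 1} \ {k | c k = 1} : Set (Fin n)).ncard = 1 → False := by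
      intro a ha b hb c hc d hd had h hx
      obtain ⟨A, A', x, y, hA, hA', hne, hxy, ea, eb, ec, ed⟩ :=
        exists_common_completions_of_sdiff_eq_singleton (hbin a ha) (hbin b hb) (hbin c hc)
          (hbin d hd) (hwt a ha) (hwt b hb) (hwt c hc) had h hx
      refine absurd (hT A A' hA hA' hne) (not_le.2 ?_)
      exact (Set.one_lt_ncard_iff (Set.toFinite _)).2
        ⟨x, y, ⟨⟨a, ha, ea⟩, ⟨d, hd, ed⟩⟩, ⟨⟨c, hc, ec⟩, ⟨b, hb, eb⟩⟩, hxy⟩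
    have c1 : C₁.card = 1 ∨ C₁.card = 2 := by omega
    have c2 : C₂.card = 1 ∨ C₂.card = 2 := by omega
    rw [card_eq_one, card_eq_two] at c1 c2
    rcases c1 with ⟨a, rfl⟩ | ⟨a, b, hab, rfl⟩ <;> rcases c2 with ⟨c, rfl⟩ | ⟨c, d, hcd, rfl⟩
    · simp only [sum_singleton] at hl hm heq
      rw [hl, hm, one_smul, one_smul] at heq
      exact hne (by rw [heq])
    · rw [sum_singleton] at hl heq
      rw [sum_pair hcd] at hm heq
      rw [hl, one_smul] at heq
      exact binary_ne_convex_comb (hbin a (hC₁ (by simp))) (hbin c (hC₂ (by simp)))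
        (hbin d (hC₂ (by simp))) hcd (hmu c (by simp)) (hmu d (by simp)) hm
        fun i => by simpa using congrFun heq i
    · rw [sum_singleton] at hm heq
      rw [sum_pair hab] at hl heq
      rw [hm, one_smul] at heq
      exact binary_ne_convex_comb (hbin c (hC₂ (by simp))) (hbin a (hC₁ (by simp)))
        (hbin b (hC₁ (by simp))) hab (hlam a (by simp)) (hlam b (by simp)) hl
        fun i => by simpa using congrFun heq.symm i
    · rw [sum_pair hab] at hl heq
      rw [sum_pair hcd] at hm heq
      have ha : a ∈ C := hC₁ (by simp)
      have hb : b ∈ C := hC₁ (by simp)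
      have hc : c ∈ C := hC₂ (by simp)
      have hd : d ∈ C := hC₂ (by simp)
      rcases binary_pair_convex_comb_eq (hbin a ha) (hbin b hb) (hbin c hc) (hbin d hd) hab
        (hlam a (by simp)) (hlam b (by simp)) (hmu c (by simp)) (hmu d (by simp)) hl hm
        (fun i => by simpa using congrFun heq i) with ⟨rfl, rfl⟩ | ⟨rfl, rfl⟩ | h
      · exact hne rfl
      · exact hne (pair_comm _ _)
      · have hac : a ≠ c := by
          rintro rfl
          exact hne (by rw [show b = d from funext fun i => by linarith [h i]])
        have had : a ≠ d := by
          rintro rfl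
          exact hne (by rw [show b = c from funext fun i => by linarith [h i], pair_comm])
        rcases ncard_support_sdiff_eq_one_or (hbin a ha) (hbin b hb) (hbin c hc) (hbin d hd)
          (hwt a ha) (hwt c hc) (hwt d hd) hac had h with hx | hx
        · exact viol a ha b hb c hc d hd had h hx
        · exact viol a ha b hb d hd c hc hac (fun i => by linarith [h i]) hx
end

section
/- Let n ≥ 3 be an integer. Every 2-signature code of length n with constant weight 3 has size at most n(n−1)/3; that is, A(n,3,2) ≤ n(n−1)/3. -/
open Finset

/-- The characteristic vector of a set of coordinates. -/
noncomputable def indicatorVec {n : ℕ} (T : Finset (Fin n)) : Fin n → ℝ :=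
  fun i => if i ∈ T then 1 else 0

lemma indicatorVec_injective {n : ℕ} :
    Function.Injective (indicatorVec : Finset (Fin n) → Fin n → ℝ) := by
  intro S T h
  ext i
  have hi := congrFun h i
  by_cases hS : i ∈ S <;> by_cases hT : i ∈ T <;> simp_all [indicatorVec]

lemma indicatorVec_insert {n : ℕ} {S : Finset (Fin n)} {v : Fin n} (hv : v ∉ S) :
    indicatorVec (insert v S) = indicatorVec S + indicatorVec {v} := by
  funext i
  by_cases hi : i = v
  · subst hi
    simp [indicatorVec, hv]
  · simp [indicatorVec, hi]

/-- The vertices completing `S` to a member of the family `F`. -/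
def coneVertices {n : ℕ} (F : Finset (Finset (Fin n))) (S : Finset (Fin n)) : Finset (Fin n) :=
  univ.filter fun v => v ∉ S ∧ insert v S ∈ F

lemma mem_coneVertices {n : ℕ} {F : Finset (Finset (Fin n))} {S : Finset (Fin n)} {v : Fin n} :
    v ∈ coneVertices F S ↔ v ∉ S ∧ insert v S ∈ F := by
  simp [coneVertices]

/-- Two disjoint pairs of codewords of a 2-signature code have different sums. -/
lemma IsSignatureCode.add_ne_add {n : ℕ} {C : Finset (Fin n → ℝ)} (hC : IsSignatureCode 2 C)
    {a b c d : Fin n → ℝ} (ha : a ∈ C) (hb : b ∈ C) (hc : c ∈ C) (hd : d ∈ C)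
    (hab : a ≠ b) (hcd : c ≠ d) (hac : a ≠ c) (had : a ≠ d) : a + b ≠ c + d := by
  intro h
  refine hC {a, b} (by simp [insert_subset_iff, ha, hb]) {c, d}
    (by simp [insert_subset_iff, hc, hd]) ?_ (by simp [card_pair hab]) (by simp [card_pair hab])
    (by simp [card_pair hcd]) (by simp [card_pair hcd]) (fun _ => 1 / 2) (fun _ => 1 / 2)
    (by intros; norm_num) (by intros; norm_num) ?_ ?_ ?_
  · intro he
    have : a ∈ ({c, d} : Finset (Fin n → ℝ)) := he ▸ mem_insert_self a {b}
    simp [hac, had] at this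
  · rw [sum_pair hab]; norm_num
  · rw [sum_pair hcd]; norm_num
  · rw [sum_pair hab, sum_pair hcd, ← smul_add, ← smul_add, h]

lemma eq_of_mem_coneVertices {n : ℕ} {C : Finset (Fin n → ℝ)} (hC : IsSignatureCode 2 C)
    {F : Finset (Finset (Fin n))} (hF : ∀ T ∈ F, indicatorVec T ∈ C)
    {S S' : Finset (Fin n)} {u v : Fin n} (huv : u ≠ v)
    (hu : u ∈ coneVertices F S) (hv : v ∈ coneVertices F S)
    (hu' : u ∈ coneVertices F S') (hv' : v ∈ coneVertices F S') : S = S' := by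
  by_contra hS
  rw [mem_coneVertices] at hu hv hu' hv'
  have insert_ne {A B : Finset (Fin n)} {x y : Fin n} (hxy : x ≠ y) (hx : x ∉ B) :
      indicatorVec (insert x A) ≠ indicatorVec (insert y B) := by
    intro h
    have : x ∈ insert y B := indicatorVec_injective h ▸ mem_insert_self x A
    simp [hxy, hx] at this
  refine hC.add_ne_add (hF _ hu.2) (hF _ hv'.2) (hF _ hv.2) (hF _ hu'.2)
    (insert_ne huv hu'.1) (insert_ne huv.symm hv'.1) (insert_ne huv hu.1) ?_ ?_
  · intro h
    apply hS
    rw [← erase_insert hu.1, ← erase_insert hu'.1, indicatorVec_injective h]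
  · rw [indicatorVec_insert hu.1, indicatorVec_insert hv'.1, indicatorVec_insert hv.1,
      indicatorVec_insert hu'.1]
    abel

lemma sum_card_coneVertices {n r : ℕ} {F : Finset (Finset (Fin n))}
    (hF : ∀ T ∈ F, T.card = r + 1) :
    ∑ S ∈ powersetCard r univ, (coneVertices F S).card = F.card * (r + 1) := by
  rw [← card_sigma, ← sum_const_nat hF, ← card_sigma]
  refine card_nbij' (fun p => ⟨insert p.2 p.1, p.2⟩) (fun p => ⟨p.1.erase p.2, p.2⟩) ?_ ?_ ?_ ?_
  · rintro ⟨S, v⟩ h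
    simp only [coe_sigma, Set.mem_sigma_iff, mem_coe, mem_coneVertices] at h ⊢
    exact ⟨h.2.2, mem_insert_self _ _⟩
  · rintro ⟨T, v⟩ h
    simp only [coe_sigma, Set.mem_sigma_iff, mem_coe, mem_coneVertices, mem_powersetCard_univ]
      at h ⊢
    refine ⟨?_, notMem_erase _ _, ?_⟩
    · rw [card_erase_of_mem h.2, hF _ h.1, Nat.add_sub_cancel]
    · rw [insert_erase h.2]; exact h.1
  · rintro ⟨S, v⟩ h
    simp only [coe_sigma, Set.mem_sigma_iff, mem_coe, mem_coneVertices] at h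
    simp [erase_insert h.2.1]
  · rintro ⟨T, v⟩ h
    simp only [coe_sigma, Set.mem_sigma_iff, mem_coe] at h
    simp [insert_erase h.2]

lemma sum_choose_card_coneVertices_le {n : ℕ} {C : Finset (Fin n → ℝ)}
    (hC : IsSignatureCode 2 C) {F : Finset (Finset (Fin n))}
    (hF : ∀ T ∈ F, indicatorVec T ∈ C) (P : Finset (Finset (Fin n))) :
    ∑ S ∈ P, (coneVertices F S).card.choose 2 ≤ n.choose 2 := by
  simp_rw [← card_powersetCard]
  rw [← card_biUnion]
  · calc _ ≤ (powersetCard 2 (univ : Finset (Fin n))).card :=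
          card_le_card (biUnion_subset.2 fun S _ => powersetCard_mono (subset_univ _))
      _ = n.choose 2 := by simp
  · intro S _ S' _ hne
    refine disjoint_left.2 fun R hR hR' => hne ?_
    rw [mem_powersetCard] at hR hR'
    obtain ⟨u, v, huv, rfl⟩ := card_eq_two.1 hR.2
    exact eq_of_mem_coneVertices hC hF huv (hR.1 (by simp)) (hR.1 (by simp))
      (hR'.1 (by simp)) (hR'.1 (by simp))

lemma le_one_add_choose_two (d : ℕ) : d ≤ 1 + d.choose 2 := by
  induction d with
  | zero => simp
  | succ k ih =>
    have h : (k + 1).choose 2 = k + k.choose 2 := by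
      rw [Nat.choose_succ_succ' k 1, Nat.choose_one_right]
    rw [h]
    omega

theorem stmt_12 (n : ℕ) (hn : 3 ≤ n)
    (C : Finset (Fin n → ℝ)) (hbin : IsBinaryCode C)
    (hwt : ∀ c ∈ C, ({k | c k = 1} : Set (Fin n)).ncard = 3)
    (hsig : IsSignatureCode 2 C) :
    (C.card : ℝ) ≤ (n : ℝ) * ((n : ℝ) - 1) / 3 := by
  classical
  set F : Finset (Finset (Fin n)) := univ.filter fun T => indicatorVec T ∈ C with hFdef
  have hF : ∀ T ∈ F, indicatorVec T ∈ C := by simp [hFdef]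
  have hF3 : ∀ T ∈ F, T.card = 2 + 1 := by
    intro T hT
    have h := hwt _ (hF T hT)
    have hset : ({k | indicatorVec T k = 1} : Set (Fin n)) = T := by
      ext k
      simp [indicatorVec]
    rwa [hset, Set.ncard_coe_finset] at h
  have hCF : C.card ≤ F.card := by
    refine (card_le_card (t := F.image indicatorVec) fun c hc => ?_).trans card_image_le
    have hcT : indicatorVec (univ.filter fun i => c i = 1) = c := by
      funext i
      rcases hbin c hc i with h | h <;> simp [indicatorVec, h]
    exact mem_image.2 ⟨_, by simp [hFdef, hcT, hc], hcT⟩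
  have hbound : F.card * 3 ≤ n.choose 2 + n.choose 2 := by
    calc F.card * 3 = ∑ S ∈ powersetCard 2 univ, (coneVertices F S).card :=
          (sum_card_coneVertices hF3).symm
      _ ≤ ∑ S ∈ powersetCard 2 univ, (1 + (coneVertices F S).card.choose 2) :=
          sum_le_sum fun S _ => le_one_add_choose_two _
      _ = n.choose 2 + ∑ S ∈ powersetCard 2 univ, (coneVertices F S).card.choose 2 := by
          simp [sum_add_distrib]
      _ ≤ n.choose 2 + n.choose 2 :=
          Nat.add_le_add_left (sum_choose_card_coneVertices_le hsig hF _) _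
  have hreal : (C.card : ℝ) * 3 ≤ (n.choose 2 : ℝ) + n.choose 2 := by
    exact_mod_cast (Nat.mul_le_mul_right 3 hCF).trans hbound
  rw [Nat.cast_choose_two] at hreal
  linarith
end

section
/- Let n ≥ 1 be an integer and let C be a binary code of length n such that the family of supports F = {supp(c) : c ∈ C} is weakly union-free, i.e., for any four pairwise distinct members A, B, D, E ∈ F one has A ∪ B ≠ D ∪ E. Then C is a 2-signature code. -/
open Finset

/-- A binary vector is not a proper convex combination of two distinct binary vectors. -/
lemma eq_of_combination_eq_binary {n : ℕ} {a b d : Fin n → ℝ}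
    (ha : ∀ i, a i = 0 ∨ a i = 1) (hb : ∀ i, b i = 0 ∨ b i = 1) (hd : ∀ i, d i = 0 ∨ d i = 1)
    {p q : ℝ} (hp : 0 < p) (hq : 0 < q) (h : ∀ i, p * a i + q * b i = (p + q) * d i) : a = b := by
  funext i
  have hi := h i
  rcases ha i with h1 | h1 <;> rcases hb i with h2 | h2 <;> rcases hd i with h3 | h3 <;>
    rw [h1, h2, h3] at hi <;> rw [h1, h2] <;> linarith

/-- Two segments between binary vectors which share an endpoint and meet in their interiors have
the same second endpoint. -/
lemma eq_of_combination_eq_of_common_endpoint {n : ℕ} {a b d : Fin n → ℝ}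
    (ha : ∀ i, a i = 0 ∨ a i = 1) (hb : ∀ i, b i = 0 ∨ b i = 1) (hd : ∀ i, d i = 0 ∨ d i = 1)
    (hab : a ≠ b) (had : a ≠ d) {p q r s : ℝ} (hq : 0 < q) (hs : 0 < s)
    (hpq : p + q = 1) (hrs : r + s = 1)
    (h : ∀ i, p * a i + q * b i = r * a i + s * d i) : b = d := by
  rcases lt_trichotomy p r with hlt | heq | hgt
  · refine absurd (eq_of_combination_eq_binary ha hd hb (sub_pos.2 hlt) hs fun i => ?_) had
    rw [show r - p + s = q by linarith]
    linarith [h i]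
  · funext i
    have hi := h i
    have hsq : s = q := by linarith
    rw [heq, hsq] at hi
    exact mul_left_cancel₀ hq.ne' (add_left_cancel hi)
  · refine absurd (eq_of_combination_eq_binary ha hb hd (sub_pos.2 hgt) hq fun i => ?_) hab
    rw [show p - r + q = s by linarith]
    linarith [h i]

/-- A positive combination of two binary vectors vanishes exactly off the union of the supports. -/
lemma binary_union_eq_support {n : ℕ} {a b : Fin n → ℝ}
    (ha : ∀ i, a i = 0 ∨ a i = 1) (hb : ∀ i, b i = 0 ∨ b i = 1)
    {p q : ℝ} (hp : 0 < p) (hq : 0 < q) :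
    {k | a k = 1} ∪ {k | b k = 1} = {k | p * a k + q * b k ≠ 0} := by
  ext k
  have hpq : p + q ≠ 0 := (add_pos hp hq).ne'
  rcases ha k with h1 | h1 <;> rcases hb k with h2 | h2 <;> simp [h1, h2, hp.ne', hq.ne', hpq]

/-- A binary vector is determined by its support. -/
lemma binary_eq_of_support_eq {n : ℕ} {a b : Fin n → ℝ}
    (ha : ∀ i, a i = 0 ∨ a i = 1) (hb : ∀ i, b i = 0 ∨ b i = 1)
    (h : {k | a k = 1} = {k | b k = 1}) : a = b := by
  funext i
  have hi : a i = 1 ↔ b i = 1 := Set.ext_iff.1 h i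
  rcases ha i with h1 | h1 <;> rcases hb i with h2 | h2 <;> simp_all

theorem stmt_13 (n : ℕ) (hn : 1 ≤ n)
    (C : Finset (Fin n → ℝ)) (hbin : IsBinaryCode C)
    (huf : let F : Set (Set (Fin n)) := {S | ∃ c ∈ C, {k | c k = 1} = S};
      ∀ A ∈ F, ∀ B ∈ F, ∀ D ∈ F, ∀ E ∈ F,
        A ≠ B → A ≠ D → A ≠ E → B ≠ D → B ≠ E → D ≠ E →
        A ∪ B ≠ D ∪ E) :
    IsSignatureCode 2 C := by
  intro C₁ h₁ C₂ h₂ hne hl₁ hu₁ hl₂ hu₂ lam mu hlam hmu hs₁ hs₂ heq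
  have supp_ne : ∀ x ∈ C, ∀ y ∈ C, x ≠ y → {k | x k = 1} ≠ {k | y k = 1} :=
    fun x hx y hy hxy h => hxy (binary_eq_of_support_eq (hbin x hx) (hbin y hy) h)
  have card₁ : C₁.card = 1 ∨ C₁.card = 2 := by omega
  have card₂ : C₂.card = 1 ∨ C₂.card = 2 := by omega
  rcases card₁ with hc₁ | hc₁ <;> rcases card₂ with hc₂ | hc₂
  · obtain ⟨a, rfl⟩ := Finset.card_eq_one.1 hc₁
    obtain ⟨c, rfl⟩ := Finset.card_eq_one.1 hc₂
    simp only [sum_singleton] at hs₁ hs₂ heq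
    rw [hs₁, hs₂, one_smul, one_smul] at heq
    exact hne (by rw [heq])
  · obtain ⟨a, rfl⟩ := Finset.card_eq_one.1 hc₁
    obtain ⟨c, d, hcd, rfl⟩ := Finset.card_eq_two.1 hc₂
    simp only [sum_singleton, sum_pair hcd] at hs₁ hs₂ heq
    refine hcd (eq_of_combination_eq_binary (hbin c (h₂ (by simp))) (hbin d (h₂ (by simp)))
      (hbin a (h₁ (by simp))) (hmu c (by simp)) (hmu d (by simp)) fun i => ?_)
    rw [hs₂, ← hs₁]
    exact (congrFun heq i).symm
  · obtain ⟨a, b, hab, rfl⟩ := Finset.card_eq_two.1 hc₁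
    obtain ⟨c, rfl⟩ := Finset.card_eq_one.1 hc₂
    simp only [sum_singleton, sum_pair hab] at hs₁ hs₂ heq
    refine hab (eq_of_combination_eq_binary (hbin a (h₁ (by simp))) (hbin b (h₁ (by simp)))
      (hbin c (h₂ (by simp))) (hlam a (by simp)) (hlam b (by simp)) fun i => ?_)
    rw [hs₁, ← hs₂]
    exact congrFun heq i
  · obtain ⟨a, b, hab, rfl⟩ := Finset.card_eq_two.1 hc₁
    obtain ⟨c, d, hcd, rfl⟩ := Finset.card_eq_two.1 hc₂
    simp only [sum_pair hab, sum_pair hcd] at hs₁ hs₂ heq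
    have haC : a ∈ C := h₁ (by simp)
    have hbC : b ∈ C := h₁ (by simp)
    have hcC : c ∈ C := h₂ (by simp)
    have hdC : d ∈ C := h₂ (by simp)
    have ha := hlam a (by simp)
    have hb := hlam b (by simp)
    have hc := hmu c (by simp)
    have hd := hmu d (by simp)
    have hpt : ∀ i, lam a * a i + lam b * b i = mu c * c i + mu d * d i := congrFun heq
    by_cases hac : a = c
    · subst hac
      exact hne (by rw [eq_of_combination_eq_of_common_endpoint (hbin a haC) (hbin b hbC)
        (hbin d hdC) hab hcd hb hd hs₁ hs₂ hpt])
    by_cases had : a = d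
    · subst had
      exact hne (by rw [eq_of_combination_eq_of_common_endpoint (hbin a haC) (hbin b hbC)
        (hbin c hcC) hab hac hb hc hs₁ ((add_comm _ _).trans hs₂)
        fun i => (hpt i).trans (add_comm _ _), pair_comm])
    by_cases hbc : b = c
    · subst hbc
      exact hne (by rw [eq_of_combination_eq_of_common_endpoint (hbin b hbC) (hbin a haC)
        (hbin d hdC) hab.symm hcd ha hd ((add_comm _ _).trans hs₁) hs₂
        fun i => (add_comm _ _).trans (hpt i), pair_comm])
    by_cases hbd : b = d
    · subst hbd
      exact hac (eq_of_combination_eq_of_common_endpoint (hbin b hbC) (hbin a haC)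
        (hbin c hcC) hab.symm hbc ha hc ((add_comm _ _).trans hs₁) ((add_comm _ _).trans hs₂)
        fun i => by linarith [hpt i])
    refine huf _ ⟨a, haC, rfl⟩ _ ⟨b, hbC, rfl⟩ _ ⟨c, hcC, rfl⟩ _ ⟨d, hdC, rfl⟩
      (supp_ne a haC b hbC hab) (supp_ne a haC c hcC hac) (supp_ne a haC d hdC had)
      (supp_ne b hbC c hcC hbc) (supp_ne b hbC d hdC hbd) (supp_ne c hcC d hdC hcd) ?_
    rw [binary_union_eq_support (hbin a haC) (hbin b hbC) ha hb,
      binary_union_eq_support (hbin c hcC) (hbin d hdC) hc hd]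
    simp only [hpt]
end
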